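/- arXiv:1105.2903 — 7 statements merged into one kernel-verified Lean document; each statement's English description precedes it below -/
import Mathlib

section
/- The assignments Γ ↦ Γ ∩ G_w and G ↦ G·i_d(ℂ^×) = {g·i_d(λ) : g ∈ G, λ ∈ ℂ^×} are mutually inverse bijections between the set of subgroups Γ of Γ_w containing i_d(ℂ^×) and the set of subgroups G of G_w containing J. Concretely: (a) for every subgroup G ⊆ G_w with J ∈ G, the set G·i_d(ℂ^×) is a subgroup of Γ_w containing i_d(ℂ^×) and satisfies (G·i_d(ℂ^×)) ∩ G_w = G; (b) for every subgroup Γ ⊆ Γ_w with i_d(ℂ^×) ⊆ Γ, the subgroup G = Γ ∩ G_w contains J and satisfies G·i_d(ℂ^×) = Γ. -/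
/-- The action of a diagonal element `lam ∈ (ℂˣ)ⁿ` on a polynomial: substitute `lam j • X j`
for the variable `X j`. -/
noncomputable def scaleAct {n : ℕ} (lam : Fin n → ℂˣ) (w : MvPolynomial (Fin n) ℂ) :
    MvPolynomial (Fin n) ℂ :=
  MvPolynomial.aeval (fun j => (lam j : ℂ) • MvPolynomial.X j) w

/-- The group `G_w` of diagonal symmetries of `w`, as a set. -/
def GwSet {n : ℕ} (w : MvPolynomial (Fin n) ℂ) : Set (Fin n → ℂˣ) :=
  {lam | scaleAct lam w = w}

/-- The group `Γ_w` of diagonal transformations under which `w` is semi-invariant, as a set. -/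
def GammaWSet {n : ℕ} (w : MvPolynomial (Fin n) ℂ) : Set (Fin n → ℂˣ) :=
  {lam | ∃ c : ℂˣ, scaleAct lam w = (c : ℂ) • w}

/-- The one-parameter subgroup `i_d(λ) = (λ^{d_1}, …, λ^{d_n})`. -/
def idMapD {n : ℕ} (dw : Fin n → ℕ) (lam : ℂˣ) : Fin n → ℂˣ :=
  fun j => lam ^ dw j

/-- The exponential grading element `J = i_d(exp(2πi/d))`. -/
noncomputable def Jelt {n : ℕ} (dw : Fin n → ℕ) (d : ℕ) : Fin n → ℂˣ :=
  idMapD dw (Units.mk0 (Complex.exp (2 * Real.pi * Complex.I / d)) (Complex.exp_ne_zero _))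

theorem scaleAct_smul {n : ℕ} (lam : Fin n → ℂˣ) (c : ℂ) (w : MvPolynomial (Fin n) ℂ) :
    scaleAct lam (c • w) = c • scaleAct lam w := by
  simp only [scaleAct, map_smul]

theorem scaleAct_mul {n : ℕ} (a b : Fin n → ℂˣ) (w : MvPolynomial (Fin n) ℂ) :
    scaleAct (a * b) w = scaleAct a (scaleAct b w) := by
  unfold scaleAct
  rw [← AlgHom.comp_apply]
  congr 1
  ext j : 1
  simp [smul_smul, mul_comm]

theorem scaleAct_monomial {n : ℕ} (lam : Fin n → ℂˣ) (m : Fin n →₀ ℕ) (c : ℂ) :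
    scaleAct lam (MvPolynomial.monomial m c)
      = (∏ j, (lam j : ℂ) ^ m j) • MvPolynomial.monomial m c := by
  rw [scaleAct, MvPolynomial.aeval_monomial, MvPolynomial.monomial_eq,
    Finsupp.prod_fintype _ _ (fun _ => pow_zero _), Finsupp.prod_fintype _ _ (fun _ => pow_zero _)]
  simp only [MvPolynomial.smul_eq_C_mul, mul_pow, Finset.prod_mul_distrib, map_prod, map_pow,
    MvPolynomial.algebraMap_eq]
  ring

/-- The one-parameter subgroup `i_d` as a group homomorphism. -/
def idMapDHom {n : ℕ} (dw : Fin n → ℕ) : ℂˣ →* (Fin n → ℂˣ) where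
  toFun := idMapD dw
  map_one' := by
    funext j
    simp [idMapD]
  map_mul' a b := by
    funext j
    simp [idMapD, mul_pow]

theorem scaleAct_idMapD {n : ℕ} {dw : Fin n → ℕ} {d : ℕ} {w : MvPolynomial (Fin n) ℂ}
    (hquasi : ∀ m ∈ w.support, ∑ j, m j * dw j = d) (lam : ℂˣ) :
    scaleAct (idMapD dw lam) w = (lam : ℂ) ^ d • w := by
  have key : ∀ m ∈ w.support,
      scaleAct (idMapD dw lam) (MvPolynomial.monomial m (w.coeff m))
        = (lam : ℂ) ^ d • MvPolynomial.monomial m (w.coeff m) := by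
    intro m hm
    rw [scaleAct_monomial, ← hquasi m hm, ← Finset.prod_pow_eq_pow_sum]
    simp only [idMapD, Units.val_pow_eq_pow_val, ← pow_mul, mul_comm]
  conv_lhs => rw [w.as_sum]
  conv_rhs => rw [w.as_sum, Finset.smul_sum]
  rw [← Finset.sum_congr rfl key]
  simp only [scaleAct, map_sum]

theorem Jelt_mem_GwSet {n : ℕ} {dw : Fin n → ℕ} {d : ℕ} (hd : d ≠ 0)
    {w : MvPolynomial (Fin n) ℂ} (hquasi : ∀ m ∈ w.support, ∑ j, m j * dw j = d) :
    Jelt dw d ∈ GwSet w := by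
  change scaleAct (idMapD dw _) w = w
  rw [scaleAct_idMapD hquasi, Units.val_mk0, (Complex.isPrimitiveRoot_exp d hd).pow_eq_one,
    one_smul]

/-- `i_d` maps the `d`-th roots of unity to powers of `J`. -/
theorem idMapD_mem_of_pow_eq_one {n : ℕ} {dw : Fin n → ℕ} {d : ℕ} (hd : d ≠ 0)
    {G : Subgroup (Fin n → ℂˣ)} (hJ : Jelt dw d ∈ G) {lam : ℂˣ} (hlam : (lam : ℂ) ^ d = 1) :
    idMapD dw lam ∈ G := by
  have : NeZero d := ⟨hd⟩
  obtain ⟨k, -, hk⟩ := (Complex.isPrimitiveRoot_exp d hd).eq_pow_of_pow_eq_one hlam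
  have hlam' : lam = Units.mk0 (Complex.exp (2 * Real.pi * Complex.I / d))
      (Complex.exp_ne_zero _) ^ k := by
    ext
    rw [Units.val_pow_eq_pow_val, Units.val_mk0, hk]
  have hJk : idMapD dw lam = Jelt dw d ^ k := by
    rw [hlam']
    exact map_pow (idMapDHom dw) _ k
  exact hJk ▸ G.pow_mem hJ k

/-- the assignments `Γ ↦ Γ ∩ G_w` and `G ↦ G·i_d(ℂˣ)` are mutually inverse
bijections between subgroups of `Γ_w` containing `i_d(ℂˣ)` and subgroups of `G_w`
containing `J`. -/
theorem stmt0 (n : ℕ) (hn : 1 ≤ n) (dw : Fin n → ℕ) (hdw : ∀ j, 0 < dw j)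
    (hgcd : Finset.univ.gcd dw = 1) (d : ℕ) (hd : 1 ≤ d)
    (w : MvPolynomial (Fin n) ℂ) (hw : w ≠ 0)
    (hquasi : ∀ m ∈ w.support, ∑ j, m j * dw j = d) :
    (∀ G : Subgroup (Fin n → ℂˣ), (G : Set (Fin n → ℂˣ)) ⊆ GwSet w → Jelt dw d ∈ G →
      (∃ H : Subgroup (Fin n → ℂˣ),
        (H : Set (Fin n → ℂˣ)) = {x | ∃ g ∈ G, ∃ lam : ℂˣ, x = g * idMapD dw lam}) ∧
      {x | ∃ g ∈ G, ∃ lam : ℂˣ, x = g * idMapD dw lam} ⊆ GammaWSet w ∧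
      (∀ lam : ℂˣ, idMapD dw lam ∈ {x | ∃ g ∈ G, ∃ lam' : ℂˣ, x = g * idMapD dw lam'}) ∧
      {x | ∃ g ∈ G, ∃ lam : ℂˣ, x = g * idMapD dw lam} ∩ GwSet w = (G : Set (Fin n → ℂˣ))) ∧
    (∀ Γ : Subgroup (Fin n → ℂˣ), (Γ : Set (Fin n → ℂˣ)) ⊆ GammaWSet w →
      (∀ lam : ℂˣ, idMapD dw lam ∈ Γ) →
      Jelt dw d ∈ (Γ : Set (Fin n → ℂˣ)) ∩ GwSet w ∧
      {x | ∃ g ∈ (Γ : Set (Fin n → ℂˣ)) ∩ GwSet w, ∃ lam : ℂˣ, x = g * idMapD dw lam}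
        = (Γ : Set (Fin n → ℂˣ))) := by
  have hd0 : d ≠ 0 := by omega
  have hact : ∀ g lam, scaleAct (g * idMapD dw lam) w = (lam : ℂ) ^ d • scaleAct g w := by
    intro g lam
    rw [scaleAct_mul, scaleAct_idMapD hquasi, scaleAct_smul]
  refine ⟨fun G hG hJ => ⟨⟨G ⊔ (idMapDHom dw).range, ?_⟩, ?_, ?_, ?_⟩,
    fun Γ hΓ hid => ⟨⟨hid _, Jelt_mem_GwSet hd0 hquasi⟩, ?_⟩⟩
  · ext x
    simp only [SetLike.mem_coe, Subgroup.mem_sup, MonoidHom.mem_range, Set.mem_ofPred_eq]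
    constructor
    · rintro ⟨g, hg, _, ⟨lam, rfl⟩, rfl⟩
      exact ⟨g, hg, lam, rfl⟩
    · rintro ⟨g, hg, lam, rfl⟩
      exact ⟨g, hg, _, ⟨lam, rfl⟩, rfl⟩
  · rintro _ ⟨g, hg, lam, rfl⟩
    have hgw : scaleAct g w = w := hG hg
    exact ⟨lam ^ d, by rw [hact, hgw, Units.val_pow_eq_pow_val]⟩
  · exact fun lam => ⟨1, G.one_mem, lam, (one_mul _).symm⟩
  · ext x
    constructor
    · rintro ⟨⟨g, hg, lam, rfl⟩, hx⟩
      have hgw : scaleAct g w = w := hG hg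
      have hx' : (lam : ℂ) ^ d • w = (1 : ℂ) • w := by
        rw [one_smul]
        nth_rewrite 1 [← hgw]
        rw [← hact]
        exact hx
      exact G.mul_mem hg (idMapD_mem_of_pow_eq_one hd0 hJ (smul_left_injective ℂ hw hx'))
    · intro hx
      exact ⟨⟨x, hx, 1, ((congrArg (x * ·) (map_one (idMapDHom dw))).trans (mul_one x)).symm⟩,
        hG hx⟩
  · ext x
    constructor
    · rintro ⟨g, ⟨hg, -⟩, lam, rfl⟩
      exact Γ.mul_mem hg (hid lam)
    · intro hx
      obtain ⟨c, hc⟩ := hΓ hx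
      obtain ⟨z, hz⟩ := IsAlgClosed.exists_pow_nat_eq (c : ℂ) (Nat.pos_of_ne_zero hd0)
      have hz0 : z ≠ 0 := by
        rintro rfl
        rw [zero_pow hd0] at hz
        exact c.ne_zero hz.symm
      let lam := Units.mk0 z hz0
      refine ⟨x * idMapD dw lam⁻¹, ⟨Γ.mul_mem hx (hid _), ?_⟩, lam, ?_⟩
      · change scaleAct _ w = w
        rw [hact, hc, smul_smul, ← hz, Units.val_inv_eq_inv_val, Units.val_mk0, ← mul_pow,
          inv_mul_cancel₀ hz0, one_pow, one_smul]
      · have hinv : idMapD dw lam⁻¹ = (idMapD dw lam)⁻¹ := map_inv (idMapDHom dw) lam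
        rw [hinv, inv_mul_cancel_right]
end

section
/- Let γ_0 ∈ G_w and set I(γ_0) = {j ∈ {1,…,n} : (γ_0)_j = 1}; assume I(γ_0) ≠ ∅. Then for every γ ∈ Γ_w such that γ_j = 1 for all j ∈ I(γ_0), one has χ_w(γ) = 1. Equivalently, any two elements of Γ_w whose coordinates indexed by I(γ_0) agree have the same value of χ_w, i.e. the character χ_w factors through the coordinate projection of Γ_w onto the coordinates indexed by I(γ_0). -/
lemma coeff_scaleAct {n : ℕ} (lam : Fin n → ℂˣ) (w : MvPolynomial (Fin n) ℂ) (m : Fin n →₀ ℕ) :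
    MvPolynomial.coeff m (scaleAct lam w) =
      (∏ j, (lam j : ℂ) ^ m j) * MvPolynomial.coeff m w := by
  classical
  unfold scaleAct
  induction w using MvPolynomial.induction_on' with
  | monomial u a =>
    have h : MvPolynomial.aeval (fun j => (lam j : ℂ) • (MvPolynomial.X j : MvPolynomial (Fin n) ℂ))
        (MvPolynomial.monomial u a) =
        MvPolynomial.C (∏ j, (lam j : ℂ) ^ u j) * MvPolynomial.monomial u a := by
      rw [MvPolynomial.aeval_monomial, MvPolynomial.monomial_eq,
        Finsupp.prod_fintype _ _ (by simp), Finsupp.prod_fintype _ _ (by simp)]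
      simp only [MvPolynomial.smul_eq_C_mul, mul_pow, Finset.prod_mul_distrib, map_prod, map_pow,
        MvPolynomial.algebraMap_eq]
      ring
    rw [h, MvPolynomial.coeff_C_mul, MvPolynomial.coeff_monomial]
    split_ifs with hum
    · rw [hum]
    · simp
  | add p q hp hq => rw [map_add, MvPolynomial.coeff_add, hp, hq, MvPolynomial.coeff_add, mul_add]

lemma prod_pow_eq_of_scaleAct_eq {n : ℕ} {lam : Fin n → ℂˣ} {w : MvPolynomial (Fin n) ℂ} {c : ℂ}
    (h : scaleAct lam w = c • w) {m : Fin n →₀ ℕ} (hm : m ∈ w.support) :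
    ∏ j, (lam j : ℂ) ^ m j = c := by
  have h1 := congrArg (MvPolynomial.coeff m) h
  rw [coeff_scaleAct, MvPolynomial.coeff_smul, smul_eq_mul] at h1
  exact mul_right_cancel₀ (MvPolynomial.mem_support_iff.mp hm) h1

/-- An ideal of a polynomial ring over a field that vanishes on a coordinate axis has infinite
codimension. -/
lemma not_finiteDimensional_quotient_of_le_ker {K σ : Type*} [Field K]
    [DecidableEq σ] (j : σ) (I : Ideal (MvPolynomial σ K))
    (hI : I ≤ RingHom.ker (MvPolynomial.aeval
      (fun i => if i = j then (Polynomial.X : Polynomial K) else 0))) :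
    ¬ FiniteDimensional K (MvPolynomial σ K ⧸ I) := by
  intro hfin
  let φ : MvPolynomial σ K →ₐ[K] Polynomial K :=
    MvPolynomial.aeval (fun i => if i = j then (Polynomial.X : Polynomial K) else 0)
  have hsurj : Function.Surjective φ := by
    intro p
    refine ⟨Polynomial.aeval (MvPolynomial.X j) p, ?_⟩
    rw [← Polynomial.aeval_algHom_apply]
    simp [φ]
  have hsurj' : Function.Surjective (Ideal.Quotient.liftₐ I φ hI) := fun p => by
    obtain ⟨q, rfl⟩ := hsurj p
    exact ⟨Ideal.Quotient.mk I q, rfl⟩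
  exact Polynomial.not_finite
    (Module.Finite.of_surjective (Ideal.Quotient.liftₐ I φ hI).toLinearMap hsurj')

/-- if `w` is quasihomogeneous with an isolated singularity at the origin,
`γ₀ ∈ G_w` has a nonempty set `I(γ₀)` of coordinates where it acts trivially, then any
`γ ∈ Γ_w` that acts trivially on the coordinates in `I(γ₀)` has `χ_w(γ) = 1`; that is,
the character `χ_w` factors through the coordinate projection onto `I(γ₀)`. -/
theorem stmt2 (n : ℕ) (hn : 1 ≤ n) (dw : Fin n → ℕ) (hdw : ∀ j, 0 < dw j)
    (hgcd : Finset.univ.gcd dw = 1) (d : ℕ) (hd : 1 ≤ d)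
    (w : MvPolynomial (Fin n) ℂ) (hw : w ≠ 0)
    (hquasi : ∀ m ∈ w.support, ∑ j, m j * dw j = d)
    (hiso : FiniteDimensional ℂ
      (MvPolynomial (Fin n) ℂ ⧸
        Ideal.span (Set.range fun j : Fin n => MvPolynomial.pderiv j w)))
    (γ0 : Fin n → ℂˣ) (hγ0 : scaleAct γ0 w = w) (hI : ∃ j, γ0 j = 1)
    (γ : Fin n → ℂˣ) (c : ℂˣ) (hγ : scaleAct γ w = (c : ℂ) • w)
    (hγtriv : ∀ j, γ0 j = 1 → γ j = 1) :
    c = 1 := by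
  classical
  by_contra hc
  obtain ⟨j, hj⟩ := hI
  have hsupp : ∀ m ∈ w.support, ∃ i, γ0 i ≠ 1 ∧ m i ≠ 0 := by
    intro m hm
    by_contra! hall
    refine hc (Units.ext ?_)
    rw [← prod_pow_eq_of_scaleAct_eq hγ hm, Units.val_one]
    refine Finset.prod_eq_one fun i _ => ?_
    by_cases hi : γ0 i = 1
    · simp [hγtriv i hi]
    · simp [hall i hi]
  refine not_finiteDimensional_quotient_of_le_ker j _ (Ideal.span_le.mpr ?_) hiso
  rintro _ ⟨k, rfl⟩
  simp only [SetLike.mem_coe, RingHom.mem_ker]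
  rw [w.as_sum, map_sum, map_sum]
  refine Finset.sum_eq_zero fun m hm => ?_
  rw [MvPolynomial.pderiv_monomial, MvPolynomial.aeval_monomial,
    Finsupp.prod_fintype _ _ (by simp)]
  suffices h : ∃ i, i ≠ j ∧ (m - Finsupp.single k 1 : Fin n →₀ ℕ) i ≠ 0 by
    obtain ⟨i, hij, hi⟩ := h
    rw [Finset.prod_eq_zero (Finset.mem_univ i), mul_zero]
    rw [if_neg hij, zero_pow hi]
  by_contra! hall
  obtain ⟨i, hi, hmi⟩ := hsupp m hm
  have hij : i ≠ j := fun h => hi (h ▸ hj)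
  have hik : i = k := by
    by_contra hik
    exact hmi (by simpa [Finsupp.single_apply, Ne.symm hik] using hall i hij)
  subst hik
  have hm1 : m i = 1 := by
    have := hall i hij
    simp at this
    omega
  have hprod := prod_pow_eq_of_scaleAct_eq (c := 1) (by rw [hγ0, one_smul]) hm
  rw [Finset.prod_eq_single i, hm1, pow_one] at hprod
  · exact hi (Units.ext hprod)
  · intro b _ hb
    by_cases hbj : b = j
    · simp [hbj, hj]
    · have : m b = 0 := by simpa [Finsupp.single_apply, Ne.symm hb] using hall b hbj
      simp [this]
  · simp
end

section
/- Let G ⊆ (ℂ^×)^n be a finite subgroup such that G ∩ i_d(ℂ^×) = {i_d(μ) : μ ∈ ℂ^×, μ^d = 1}. Then there exist vectors k_1,…,k_n ∈ ℤ^n with Σ_j (k_i)_j·d_j = d for every i = 1,…,n, such that G = {λ ∈ (ℂ^×)^n : λ^{k_i} = 1 for all i = 1,…,n}. In other words, G is the common kernel of n Laurent-monomial characters of (ℂ^×)^n, each of weighted degree d with respect to the weights d_1,…,d_n. -/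
/-- The one-parameter subgroup `i_d(λ) = (λ^{d_1}, …, λ^{d_n})` for integer exponents. -/
def idMapZ {n : ℕ} (dw : Fin n → ℤ) (lam : ℂˣ) : Fin n → ℂˣ :=
  fun j => lam ^ dw j

/-- Every character of `μ_Nⁿ` is the restriction of a Laurent monomial. -/
theorem exists_monomial_eq_of_hom_rootsOfUnity {n N : ℕ} [NeZero N]
    (χ : (Fin n → rootsOfUnity N ℂ) →* ℂˣ) :
    ∃ k : Fin n → ℤ, ∀ a, χ a = ∏ j, (a j : ℂˣ) ^ k j := by
  have h (j : Fin n) : ∃ m : ℤ, ∀ z : rootsOfUnity N ℂ,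
      χ (Pi.mulSingle j z) = (z : ℂˣ) ^ m := by
    let σ : rootsOfUnity N ℂ →* rootsOfUnity N ℂ :=
      (χ.comp (MonoidHom.mulSingle (fun _ => rootsOfUnity N ℂ) j)).codRestrict _ fun z => by
        rw [mem_rootsOfUnity, ← map_pow]
        have hz : z ^ N = 1 := Subtype.ext ((mem_rootsOfUnity N _).1 z.2)
        rw [hz, map_one]
    obtain ⟨m, hm⟩ := MonoidHom.map_cyclic σ
    exact ⟨m, fun z => by simpa [σ] using congrArg Subtype.val (hm z)⟩
  choose k hk using h
  refine ⟨k, fun a => ?_⟩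
  conv_lhs => rw [← Finset.univ_prod_mulSingle a]
  rw [map_prod]
  exact Finset.prod_congr rfl fun j _ => hk j _

/-- Laurent monomials separate a finite subgroup of a torus from the points outside it. -/
theorem exists_monomial_separating {n : ℕ} (G : Subgroup (Fin n → ℂˣ)) [Finite G]
    {lam : Fin n → ℂˣ} (hlam : lam ∉ G) :
    ∃ k : Fin n → ℤ, (∀ g ∈ G, ∏ j, g j ^ k j = 1) ∧ ∏ j, lam j ^ k j ≠ 1 := by
  have hG (g) (hg : g ∈ G) : g ^ Nat.card G = 1 :=
    congrArg Subtype.val (pow_card_eq_one' (x := (⟨g, hg⟩ : G)))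
  have : NeZero (Nat.card G) := ⟨Nat.card_pos.ne'⟩
  generalize Nat.card G = N at hG this
  by_cases hN : ∃ j, lam j ^ N ≠ 1
  · obtain ⟨j, hj⟩ := hN
    have key (x : Fin n → ℂˣ) : ∏ i, x i ^ (Pi.single j (N : ℤ) : Fin n → ℤ) i = x j ^ N := by
      rw [Finset.prod_eq_single j (fun i _ hi => by simp [hi]) (by simp)]
      simp
    refine ⟨Pi.single j (N : ℤ), fun g hg => ?_, by rwa [key]⟩
    rw [key]
    exact congrFun (hG g hg) j
  · push Not at hN
    let f : (Fin n → rootsOfUnity N ℂ) →* (Fin n → ℂˣ) :=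
      (rootsOfUnity N ℂ).subtype.compLeft (Fin n)
    let H := G.comap f
    let a : Fin n → rootsOfUnity N ℂ := fun j => ⟨lam j, (mem_rootsOfUnity _ _).2 (hN j)⟩
    have ha : (QuotientGroup.mk' H a) ≠ 1 := by
      rw [QuotientGroup.mk'_apply, Ne, QuotientGroup.eq_one_iff]
      exact hlam
    have : NeZero (Monoid.exponent ((Fin n → rootsOfUnity N ℂ) ⧸ H)) :=
      ⟨Monoid.exponent_ne_zero_of_finite⟩
    obtain ⟨φ, hφ⟩ := CommGroup.exists_apply_ne_one_of_hasEnoughRootsOfUnity _ ℂ ha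
    obtain ⟨k, hk⟩ := exists_monomial_eq_of_hom_rootsOfUnity (φ.comp (QuotientGroup.mk' H))
    refine ⟨k, fun g hg => ?_, fun h => hφ ((hk a).trans h)⟩
    let b : Fin n → rootsOfUnity N ℂ :=
      fun j => ⟨g j, (mem_rootsOfUnity _ _).2 (congrFun (hG g hg) j)⟩
    have hb : QuotientGroup.mk' H b = 1 := by
      rw [QuotientGroup.mk'_apply, QuotientGroup.eq_one_iff]
      exact hg
    refine (hk b).symm.trans ?_
    rw [MonoidHom.comp_apply, hb, map_one]

/-- The exponent vectors of the Laurent monomials that are trivial on `G`. -/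
def trivialMonomials {n : ℕ} (G : Subgroup (Fin n → ℂˣ)) : Submodule ℤ (Fin n → ℤ) :=
  AddSubgroup.toIntSubmodule
    { carrier := {k | ∀ g ∈ G, ∏ j, g j ^ k j = 1}
      zero_mem' := by simp
      add_mem' := fun {k l} hk hl g hg => by
        simp [zpow_add, Finset.prod_mul_distrib, hk g hg, hl g hg]
      neg_mem' := fun {k} hk g hg => by simp [hk g hg] }

theorem mem_trivialMonomials {n : ℕ} {G : Subgroup (Fin n → ℂˣ)} {k : Fin n → ℤ} :
    k ∈ trivialMonomials G ↔ ∀ g ∈ G, ∏ j, g j ^ k j = 1 := Iff.rfl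

/-- A finite subgroup of a torus is the common kernel of the monomials trivial on it. -/
theorem mem_iff_forall_trivialMonomials {n : ℕ} (G : Subgroup (Fin n → ℂˣ)) [Finite G]
    {lam : Fin n → ℂˣ} :
    lam ∈ G ↔ ∀ k ∈ trivialMonomials G, ∏ j, lam j ^ k j = 1 := by
  refine ⟨fun h k hk => hk lam h, fun h => ?_⟩
  by_contra hlam
  obtain ⟨k, hk, hne⟩ := exists_monomial_separating G hlam
  exact hne (h k hk)

/-- A submodule of `ℤⁿ` on which a linear form takes the value `c ≠ 0`, and only multiples
of `c`, is spanned by `n` vectors at which the form equals `c`. -/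
theorem exists_span_eq_of_linearForm {n : ℕ} (L : Submodule ℤ (Fin n → ℤ))
    (w : (Fin n → ℤ) →ₗ[ℤ] ℤ) {c : ℤ} (hc : c ≠ 0) {v : Fin n → ℤ} (hvL : v ∈ L)
    (hv : w v = c) (hdvd : ∀ k ∈ L, c ∣ w k) :
    ∃ k : Fin n → Fin n → ℤ, (∀ i, w (k i) = c) ∧ Submodule.span ℤ (Set.range k) = L := by
  let K := L ⊓ LinearMap.ker w
  have hrank : Module.finrank ℤ K < n := by
    have h1 : Module.finrank ℤ K ≤ Module.finrank ℤ (LinearMap.ker w) :=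
      Submodule.finrank_mono inf_le_right
    have h2 := (LinearMap.ker w).finrank_quotient_add_finrank
    rw [w.quotKerEquivRange.finrank_eq, Module.finrank_fin_fun] at h2
    have : Nontrivial (LinearMap.range w) :=
      ⟨⟨⟨c, v, hv⟩, 0, fun h => hc (congrArg Subtype.val h)⟩⟩
    have h3 : 0 < Module.finrank ℤ (LinearMap.range w) := Module.finrank_pos
    omega
  let b := Module.finBasis ℤ K
  obtain ⟨e⟩ : Nonempty (Option (Fin (Module.finrank ℤ K)) ↪ Fin n) :=
    Function.Embedding.nonempty_of_card_le (by simpa using hrank)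
  let t : Option (Fin (Module.finrank ℤ K)) → K := fun o => o.elim 0 b
  let k : Fin n → Fin n → ℤ := fun i => v + t (Function.invFun e i)
  have hke (o) : k (e o) = v + t o := by
    simp only [k, Function.leftInverse_invFun e.injective o]
  have hkS (o) : v + (t o : Fin n → ℤ) ∈ Submodule.span ℤ (Set.range k) :=
    hke o ▸ Submodule.subset_span ⟨_, rfl⟩
  have hvS : v ∈ Submodule.span ℤ (Set.range k) := by simpa [t] using hkS none
  have hKS : K ≤ Submodule.span ℤ (Set.range k) := by
    have hb : (⊤ : Submodule ℤ K) ≤ (Submodule.span ℤ (Set.range k)).comap K.subtype := by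
      rw [← b.span_eq, Submodule.span_le]
      rintro _ ⟨i, rfl⟩
      exact (Submodule.add_mem_iff_right _ hvS).1 (hkS (some i))
    exact fun x hx => hb (Submodule.mem_top (x := (⟨x, hx⟩ : K)))
  refine ⟨k, fun i => ?_, le_antisymm ?_ fun x hx => ?_⟩
  · have h0 : w (t (Function.invFun e i)) = 0 := (t (Function.invFun e i)).2.2
    simp only [k, map_add, hv, h0, add_zero]
  · rw [Submodule.span_le]
    rintro _ ⟨i, rfl⟩
    exact L.add_mem hvL (t (Function.invFun e i)).2.1
  · obtain ⟨s, hs⟩ := hdvd x hx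
    have hK : x - s • v ∈ K := by
      refine ⟨L.sub_mem hx (L.smul_mem s hvL), ?_⟩
      rw [SetLike.mem_coe, LinearMap.mem_ker, map_sub, map_smul, hv, hs, smul_eq_mul, mul_comm, sub_self]
    simpa using add_mem (hKS hK) (Submodule.smul_mem _ s hvS)

theorem exists_sum_mul_eq_one_of_gcd_eq_one {n : ℕ} {dw : Fin n → ℤ}
    (hgcd : Finset.univ.gcd dw = 1) : ∃ a : Fin n → ℤ, ∑ j, a j * dw j = 1 := by
  obtain ⟨g, hg⟩ := IsPrincipalIdealRing.principal (Ideal.span (Set.range dw))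
  have hg1 : g ∣ 1 := by
    rw [← hgcd]
    refine Finset.dvd_gcd fun j _ => ?_
    rw [← Ideal.mem_span_singleton, Ideal.span, ← hg]
    exact Ideal.subset_span ⟨j, rfl⟩
  rw [← Ideal.mem_span_singleton, Ideal.span, ← hg] at hg1
  simpa using Submodule.mem_span_range_iff_exists_fun ℤ |>.1 hg1

theorem prod_idMapZ_zpow {n : ℕ} (dw k : Fin n → ℤ) (μ : ℂˣ) :
    ∏ j, idMapZ dw μ j ^ k j = μ ^ ∑ j, k j * dw j := by
  have h (s : Finset (Fin n)) : ∏ j ∈ s, idMapZ dw μ j ^ k j = μ ^ ∑ j ∈ s, k j * dw j := by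
    classical
    induction s using Finset.induction_on with
    | empty => simp
    | insert a s ha ih =>
      rw [Finset.prod_insert ha, Finset.sum_insert ha, ih, zpow_add, idMapZ, ← zpow_mul,
        mul_comm (dw a)]
  exact h _

theorem idMapZ_injective {n : ℕ} {dw : Fin n → ℤ} (hgcd : Finset.univ.gcd dw = 1) :
    Function.Injective (idMapZ dw) := by
  obtain ⟨a, ha⟩ := exists_sum_mul_eq_one_of_gcd_eq_one hgcd
  intro μ ν h
  have hμ := prod_idMapZ_zpow dw a μ
  rw [h, prod_idMapZ_zpow, ha, zpow_one, zpow_one] at hμ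
  exact hμ.symm

theorem exists_units_isPrimitiveRoot (m : ℕ) [NeZero m] : ∃ ζ : ℂˣ, IsPrimitiveRoot ζ m := by
  have h := Complex.isPrimitiveRoot_exp m (NeZero.ne m)
  exact ⟨_, h.isUnit_unit (NeZero.ne m)⟩

/-- a finite subgroup `G ⊆ (ℂˣ)ⁿ` with `G ∩ i_d(ℂˣ) = i_d(μ_d)` is the common
kernel of `n` Laurent-monomial characters `λ ↦ λ^{k_i}`, each of weighted degree `d`
(i.e. `∑_j (k_i)_j d_j = d`). -/
theorem stmt3 (n : ℕ) (hn : 1 ≤ n) (dw : Fin n → ℤ)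
    (hgcd : Finset.univ.gcd dw = 1) (d : ℕ) (hd : 1 ≤ d)
    (G : Subgroup (Fin n → ℂˣ)) (hGfin : (G : Set (Fin n → ℂˣ)).Finite)
    (hint : (G : Set (Fin n → ℂˣ)) ∩ Set.range (idMapZ dw)
      = idMapZ dw '' {μ : ℂˣ | μ ^ d = 1}) :
    ∃ k : Fin n → Fin n → ℤ,
      (∀ i, ∑ j, k i j * dw j = (d : ℤ)) ∧
      (G : Set (Fin n → ℂˣ)) = {lam | ∀ i, ∏ j, lam j ^ k i j = 1} := by
  have : Finite G := hGfin
  have hmem (μ : ℂˣ) : idMapZ dw μ ∈ G ↔ μ ^ d = 1 := by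
    have h : idMapZ dw μ ∈ (G : Set (Fin n → ℂˣ)) ∩ Set.range (idMapZ dw) ↔ μ ^ d = 1 := by
      rw [hint, (idMapZ_injective hgcd).mem_set_image]
      rfl
    simpa using h
  let w : (Fin n → ℤ) →ₗ[ℤ] ℤ := Fintype.linearCombination ℤ dw
  have hw (k) : w k = ∑ j, k j * dw j := by
    simp [w, Fintype.linearCombination_apply]
  have hdvd (k) (hk : k ∈ trivialMonomials G) : (d : ℤ) ∣ w k := by
    have : NeZero d := ⟨by omega⟩
    obtain ⟨ζ, hζ⟩ := exists_units_isPrimitiveRoot d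
    rw [← hζ.zpow_eq_one_iff_dvd, hw, ← prod_idMapZ_zpow]
    exact hk _ ((hmem ζ).2 hζ.pow_eq_one)
  obtain ⟨m, hm⟩ := IsPrincipalIdealRing.principal ((trivialMonomials G).map w)
  have hroot (r : ℕ) [NeZero r] (hr : (r : ℤ) ∣ m) : r ∣ d := by
    obtain ⟨ζ, hζ⟩ := exists_units_isPrimitiveRoot r
    rw [← hζ.pow_eq_one_iff_dvd, ← hmem, mem_iff_forall_trivialMonomials]
    intro k hk
    rw [prod_idMapZ_zpow, ← hw, hζ.zpow_eq_one_iff_dvd]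
    have hk' : w k ∈ (trivialMonomials G).map w := Submodule.mem_map_of_mem hk
    rw [hm] at hk'
    exact hr.trans (Ideal.mem_span_singleton.1 hk')
  have hmd : m ∣ d := by
    rcases eq_or_ne m 0 with rfl | hm0
    · have := Nat.le_of_dvd (by omega) (hroot (d + 1) (dvd_zero _))
      omega
    · have : NeZero m.natAbs := ⟨Int.natAbs_ne_zero.2 hm0⟩
      exact Int.natAbs_dvd.1 (Int.natCast_dvd_natCast.2 (hroot m.natAbs (Int.natAbs_dvd.2 dvd_rfl)))
  obtain ⟨v, hvL, hv⟩ : (d : ℤ) ∈ (trivialMonomials G).map w := by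
    rw [hm]
    exact Ideal.mem_span_singleton.2 hmd
  obtain ⟨k, hk, hspan⟩ := exists_span_eq_of_linearForm _ w (by omega) hvL hv hdvd
  refine ⟨k, fun i => (hw _).symm.trans (hk i), Set.ext fun lam => ?_⟩
  rw [SetLike.mem_coe, mem_iff_forall_trivialMonomials, Set.mem_ofPred_eq]
  refine ⟨fun h i => h _ (hspan ▸ Submodule.subset_span ⟨i, rfl⟩), fun h l hl => ?_⟩
  have hle : trivialMonomials G ≤ trivialMonomials (Subgroup.zpowers lam) := by
    rw [← hspan, Submodule.span_le]
    rintro _ ⟨i, rfl⟩ _ ⟨s, rfl⟩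
    simp only [Pi.pow_apply, zpow_comm _ s, Finset.prod_zpow, h i, one_zpow]
  exact hle hl lam (Subgroup.mem_zpowers lam)
end

section
/- Let b_1,…,b_r ∈ R be a regular sequence and let a_1,…,a_r ∈ R satisfy Σ_i a_i·b_i = 0. Let b^* : R^r → R be the R-linear functional with b^*(e_i) = b_i, set a = Σ_i a_i·e_i ∈ R^r, and let D = a∧(−) + ι_{b^*} on ⋀(R^r). Then: (1) D∘D = 0; (2) ker(D) ∩ ⋀^{odd} = D(⋀^{even}); and (3) the projection ⋀^{even} → ⋀^0(R^r) = R followed by the quotient map R → R/(b_1,…,b_r) induces an isomorphism of R-modules (ker(D) ∩ ⋀^{even}) / D(⋀^{odd}) ≅ R/(b_1,…,b_r). (This is the affine case of the statement that for a regular Koszul matrix factorization {a,b} of 0 one has H^1({a,b}) = 0 and H^0({a,b}) ≅ the structure ring of the zero locus of b.) -/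
/-- The ℤ/2-folded Koszul differential `D = a∧(-) + ι_{b^*}` on `⋀(Rʳ)`, where
`b^* : Rʳ → R` is the functional with `b^*(e_i) = b_i`. -/
noncomputable def koszulD {R : Type*} [CommRing R] {r : ℕ} (a b : Fin r → R) :
    ExteriorAlgebra R (Fin r → R) →ₗ[R] ExteriorAlgebra R (Fin r → R) :=
  LinearMap.mulLeft R (ExteriorAlgebra.ι R a) +
    CliffordAlgebra.contractLeft (Q := (0 : QuadraticForm R (Fin r → R)))
      (∑ i, b i • LinearMap.proj i)

/-- The even part `⋀^{even}(Rʳ)`. -/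
noncomputable def evenPart (R : Type*) [CommRing R] (r : ℕ) :
    Submodule R (ExteriorAlgebra R (Fin r → R)) :=
  CliffordAlgebra.evenOdd (0 : QuadraticForm R (Fin r → R)) 0

/-- The odd part `⋀^{odd}(Rʳ)`. -/
noncomputable def oddPart (R : Type*) [CommRing R] (r : ℕ) :
    Submodule R (ExteriorAlgebra R (Fin r → R)) :=
  CliffordAlgebra.evenOdd (0 : QuadraticForm R (Fin r → R)) 1

section Contraction

variable {R M : Type*} [CommRing R] [AddCommGroup M] [Module R M]

/-- Contraction of the exterior algebra by a linear functional. -/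
noncomputable abbrev contr (f : Module.Dual R M) :
    ExteriorAlgebra R M →ₗ[R] ExteriorAlgebra R M :=
  CliffordAlgebra.contractLeft (Q := (0 : QuadraticForm R M)) f

theorem contr_ι_mul (f : Module.Dual R M) (v : M) (x : ExteriorAlgebra R M) :
    contr f (ExteriorAlgebra.ι R v * x) = f v • x - ExteriorAlgebra.ι R v * contr f x :=
  CliffordAlgebra.contractLeft_ι_mul _ _ _

theorem contr_algebraMap (f : Module.Dual R M) (c : R) :
    contr f (algebraMap R (ExteriorAlgebra R M) c) = 0 :=
  CliffordAlgebra.contractLeft_algebraMap _ _ _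

theorem contr_contr (f : Module.Dual R M) (x : ExteriorAlgebra R M) : contr f (contr f x) = 0 :=
  CliffordAlgebra.contractLeft_contractLeft _ _

theorem contr_comm (f g : Module.Dual R M) (x : ExteriorAlgebra R M) :
    contr f (contr g x) = -contr g (contr f x) :=
  CliffordAlgebra.contractLeft_comm _ _ _

theorem ι_mul_ι_eq_neg (u v : M) :
    ExteriorAlgebra.ι R u * ExteriorAlgebra.ι R v =
      -(ExteriorAlgebra.ι R v * ExteriorAlgebra.ι R u) :=
  eq_neg_of_add_eq_zero_left (ExteriorAlgebra.ι_add_mul_swap u v)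

theorem algebraMapInv_ι (v : M) :
    ExteriorAlgebra.algebraMapInv (ExteriorAlgebra.ι R v) = 0 := by
  simp [ExteriorAlgebra.algebraMapInv]

/-- The projection along `v` onto the kernel of `f`, when `f v = 1`. -/
theorem map_sub_smulRight (f : Module.Dual R M) (v : M) (x : ExteriorAlgebra R M) :
    ExteriorAlgebra.map (LinearMap.id - f.smulRight v) x =
      x - ExteriorAlgebra.ι R v * contr f x := by
  induction x using CliffordAlgebra.left_induction with
  | algebraMap c => rw [contr_algebraMap]; simp
  | add x y hx hy => rw [map_add, hx, hy, map_add, mul_add]; abel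
  | ι_mul x w hx =>
    change ExteriorAlgebra.map _ (ExteriorAlgebra.ι R w * x) =
      ExteriorAlgebra.ι R w * x - _ * contr f (ExteriorAlgebra.ι R w * x)
    have h1 : ExteriorAlgebra.ι R v * (ExteriorAlgebra.ι R v * contr f x) = 0 := by
      rw [← mul_assoc, ExteriorAlgebra.ι_sq_zero, zero_mul]
    have h2 : ExteriorAlgebra.ι R v * (ExteriorAlgebra.ι R w * contr f x) =
        -(ExteriorAlgebra.ι R w * (ExteriorAlgebra.ι R v * contr f x)) := by
      rw [← mul_assoc, ι_mul_ι_eq_neg, neg_mul, mul_assoc]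
    rw [map_mul, hx, ExteriorAlgebra.map_apply_ι, contr_ι_mul]
    simp only [LinearMap.sub_apply, LinearMap.id_apply, LinearMap.smulRight_apply, map_sub,
      map_smul, sub_mul, mul_sub, smul_mul_assoc, mul_smul_comm, h1, h2]
    module

theorem map_zero_eq (x : ExteriorAlgebra R M) :
    ExteriorAlgebra.map (0 : M →ₗ[R] M) x =
      algebraMap R _ (ExteriorAlgebra.algebraMapInv x) := by
  have : ExteriorAlgebra.map (0 : M →ₗ[R] M) =
      (Algebra.ofId R _).comp (ExteriorAlgebra.algebraMapInv (R := R) (M := M)) := by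
    ext v
    simp [algebraMapInv_ι]
  rw [this]
  rfl

/-- The parity-`n` part of the exterior algebra. -/
noncomputable abbrev parityPart (R M : Type*) [CommRing R] [AddCommGroup M] [Module R M]
    (n : ZMod 2) : Submodule R (ExteriorAlgebra R M) :=
  CliffordAlgebra.evenOdd (0 : QuadraticForm R M) n

theorem mul_mem_parityPart {m n : ZMod 2} {x y : ExteriorAlgebra R M}
    (hx : x ∈ parityPart R M m) (hy : y ∈ parityPart R M n) : x * y ∈ parityPart R M (m + n) :=
  SetLike.mul_mem_graded (A := parityPart R M) hx hy

theorem ι_mem_parityPart (v : M) : ExteriorAlgebra.ι R v ∈ parityPart R M 1 :=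
  CliffordAlgebra.ι_mem_evenOdd_one _ v

theorem ι_mul_mem_parityPart {n : ZMod 2} (v : M) {x : ExteriorAlgebra R M}
    (hx : x ∈ parityPart R M n) : ExteriorAlgebra.ι R v * x ∈ parityPart R M (n + 1) :=
  add_comm 1 n ▸ mul_mem_parityPart (ι_mem_parityPart v) hx

theorem algebraMap_mem_parityPart (c : R) :
    algebraMap R (ExteriorAlgebra R M) c ∈ parityPart R M 0 :=
  SetLike.algebraMap_mem_graded (parityPart R M) c

theorem contr_mem_parityPart (f : Module.Dual R M) {n : ZMod 2} {x : ExteriorAlgebra R M}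
    (hx : x ∈ parityPart R M n) : contr f x ∈ parityPart R M (n + 1) := by
  have step : ∀ (u v : M) (y : ExteriorAlgebra R M), y ∈ parityPart R M n →
      contr f y ∈ parityPart R M (n + 1) →
      contr f (ExteriorAlgebra.ι R u * ExteriorAlgebra.ι R v * y) ∈ parityPart R M (n + 1) := by
    intro u v y hy ih
    have h2 : n + 1 + 1 + 1 = n + 1 := by rw [add_assoc (n + 1)]; exact add_zero _
    rw [mul_assoc, contr_ι_mul, contr_ι_mul]
    refine sub_mem (Submodule.smul_mem _ _ (ι_mul_mem_parityPart v hy)) ?_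
    rw [mul_sub]
    refine sub_mem ?_ (h2 ▸ ι_mul_mem_parityPart u (ι_mul_mem_parityPart v ih))
    exact ι_mul_mem_parityPart u (Submodule.smul_mem _ _ hy)
  induction n using Fin.cases with
  | zero =>
    induction x, hx using CliffordAlgebra.even_induction with
    | algebraMap c => exact (contr_algebraMap f c).symm ▸ zero_mem _
    | add x y hx hy ihx ihy => rw [map_add]; exact add_mem ihx ihy
    | ι_mul_ι_mul u v y hy ih => exact step u v y hy ih
  | succ i =>
    obtain rfl : i = 0 := Subsingleton.elim _ _
    induction x, hx using CliffordAlgebra.odd_induction with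
    | ι v =>
      rw [contr, CliffordAlgebra.contractLeft_ι]
      exact algebraMap_mem_parityPart _
    | add x y hx hy ihx ihy => rw [map_add]; exact add_mem ihx ihy
    | ι_mul_ι_mul u v y hy ih => exact step u v y hy ih

theorem algebraMapInv_eq_zero_of_odd {x : ExteriorAlgebra R M} (hx : x ∈ parityPart R M 1) :
    ExteriorAlgebra.algebraMapInv x = 0 := by
  induction x, hx using CliffordAlgebra.odd_induction with
  | ι v => exact algebraMapInv_ι v
  | add x y hx hy ihx ihy => rw [map_add, ihx, ihy, add_zero]
  | ι_mul_ι_mul u v y hy ih => rw [map_mul, ih, mul_zero]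

/-- If `contr f w` has parity `n + 1`, it is the contraction of an element of parity `n`. -/
theorem exists_contr_eq_of_mem_parityPart (f : Module.Dual R M) (n : ZMod 2)
    {w : ExteriorAlgebra R M} (hw : contr f w ∈ parityPart R M (n + 1)) :
    ∃ y ∈ parityPart R M n, contr f y = contr f w := by
  have hc : IsCompl (parityPart R M n) (parityPart R M (n + 1)) := by
    have h := CliffordAlgebra.evenOdd_isCompl (0 : QuadraticForm R M)
    induction n using Fin.cases with
    | zero => exact h
    | succ i =>
      obtain rfl : i = 0 := Subsingleton.elim _ _
      exact h.symm
  obtain ⟨y, hy, z, hz, rfl⟩ :=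
    Submodule.mem_sup.1 (hc.sup_eq_top ▸ Submodule.mem_top : w ∈ parityPart R M n ⊔ _)
  refine ⟨y, hy, ?_⟩
  have hz' : contr f z ∈ parityPart R M n := by
    have := contr_mem_parityPart f hz
    rwa [add_assoc, show (1 : ZMod 2) + 1 = 0 from rfl, add_zero] at this
  have hz'' : contr f z ∈ parityPart R M (n + 1) := by
    have := sub_mem hw (contr_mem_parityPart f hy)
    rwa [map_add, add_sub_cancel_left] at this
  rw [map_add, Submodule.disjoint_def.1 hc.disjoint _ hz' hz'', add_zero]

/-- The twisted differential `a∧(-) + ι_f` is conjugate to `ι_f` through multiplication by an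
even unit with constant term `1`. -/
def TwistTrivial (f : Module.Dual R M) (a : M) : Prop :=
  ∃ E E' : ExteriorAlgebra R M, E ∈ parityPart R M 0 ∧ E' ∈ parityPart R M 0 ∧
    E * E' = 1 ∧ E' * E = 1 ∧ ExteriorAlgebra.algebraMapInv E = 1 ∧
    ∀ x, contr f (E * x) = E * (ExteriorAlgebra.ι R a * x + contr f x)

theorem TwistTrivial.zero (f : Module.Dual R M) : TwistTrivial f 0 :=
  ⟨1, 1, SetLike.one_mem_graded (parityPart R M), SetLike.one_mem_graded (parityPart R M),
    one_mul 1, one_mul 1, map_one _, fun x => by simp⟩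

theorem TwistTrivial.add_koszul {f : Module.Dual R M} {a : M} (h : TwistTrivial f a) (u v : M) :
    TwistTrivial f (a + (f u • v - f v • u)) := by
  obtain ⟨E, E', hE, hE', h1, h2, h3, h4⟩ := h
  set p := ExteriorAlgebra.ι R u * ExteriorAlgebra.ι R v with hp
  have hpe : p ∈ parityPart R M 0 := CliffordAlgebra.ι_mul_ι_mem_evenOdd_zero _ u v
  have hone : (1 : ExteriorAlgebra R M) ∈ parityPart R M 0 :=
    SetLike.one_mem_graded (parityPart R M)
  have hcomm : ∀ w : M, p * ExteriorAlgebra.ι R w = ExteriorAlgebra.ι R w * p := by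
    intro w
    rw [hp, mul_assoc, ι_mul_ι_eq_neg v w, mul_neg, ← mul_assoc, ι_mul_ι_eq_neg u w, neg_mul,
      neg_neg, mul_assoc]
  have hpu : p * ExteriorAlgebra.ι R u = 0 := by
    rw [hcomm, hp, ← mul_assoc, ExteriorAlgebra.ι_sq_zero, zero_mul]
  have hpv : p * ExteriorAlgebra.ι R v = 0 := by
    rw [hp, mul_assoc, ExteriorAlgebra.ι_sq_zero, mul_zero]
  have hpp : p * p = 0 := by
    rw [hp, ← mul_assoc, ← hp, hpu, zero_mul]
  have hm : ∀ {x y : ExteriorAlgebra R M}, x ∈ parityPart R M 0 → y ∈ parityPart R M 0 →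
      x * y ∈ parityPart R M 0 := fun hx hy => by
    simpa only [add_zero] using mul_mem_parityPart hx hy
  have hu1 : (1 + p) * (1 - p) = 1 := by
    rw [mul_sub, mul_one, add_mul, one_mul, hpp]; abel
  have hu2 : (1 - p) * (1 + p) = 1 := by
    rw [mul_add, mul_one, sub_mul, one_mul, hpp]; abel
  refine ⟨E * (1 + p), (1 - p) * E', hm hE (add_mem hone hpe), hm (sub_mem hone hpe) hE',
    ?_, ?_, ?_, fun x => ?_⟩
  · rw [mul_assoc, ← mul_assoc (1 + p), hu1, one_mul, h1]
  · rw [mul_assoc, ← mul_assoc E', h2, one_mul, hu2]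
  · simp [h3, hp, algebraMapInv_ι]
  · have hc : contr f (p * x) =
        f u • (ExteriorAlgebra.ι R v * x) - f v • (ExteriorAlgebra.ι R u * x) + p * contr f x := by
      rw [hp, mul_assoc, contr_ι_mul, contr_ι_mul, mul_sub, mul_smul_comm, mul_assoc]
      abel
    have hpu' : p * (ExteriorAlgebra.ι R u * x) = 0 := by rw [← mul_assoc, hpu, zero_mul]
    have hpv' : p * (ExteriorAlgebra.ι R v * x) = 0 := by rw [← mul_assoc, hpv, zero_mul]
    have hpa : p * (ExteriorAlgebra.ι R a * x) = ExteriorAlgebra.ι R a * (p * x) := by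
      rw [← mul_assoc, hcomm, mul_assoc]
    rw [mul_assoc, h4, mul_assoc]
    congr 1
    simp only [add_mul, one_mul, mul_add, map_add, hc, map_sub, map_smul, sub_mul, mul_sub,
      smul_mul_assoc, mul_smul_comm, hpu', hpv', hpa]
    module

end Contraction

section Koszul

variable {R : Type*} [CommRing R] {r : ℕ}

/-- The functional `b^*` with `b^*(e_i) = b_i`. -/
noncomputable abbrev bStar (b : Fin r → R) : Module.Dual R (Fin r → R) :=
  ∑ i, b i • LinearMap.proj i

theorem bStar_apply (b v : Fin r → R) : bStar b v = ∑ i, b i * v i := by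
  simp

theorem bStar_single (b : Fin r → R) (i : Fin r) : bStar b (Pi.single i 1) = b i := by
  simp [bStar_apply, Pi.single_apply]

theorem contr_bStar (b : Fin r → R) (x : ExteriorAlgebra R (Fin r → R)) :
    contr (bStar b) x = ∑ i, b i • contr (LinearMap.proj i) x := by
  simp [contr]

theorem koszulD_apply (a b : Fin r → R) (x : ExteriorAlgebra R (Fin r → R)) :
    koszulD a b x = ExteriorAlgebra.ι R a * x + contr (bStar b) x :=
  rfl

/-- The ideal generated by the first `k` entries of `b`. -/
def initialIdeal (b : Fin r → R) (k : ℕ) : Ideal R :=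
  Ideal.span {y : R | ∃ j : Fin r, (j : ℕ) < k ∧ y = b j}

theorem initialIdeal_zero (b : Fin r → R) : initialIdeal b 0 = ⊥ := by
  simp [initialIdeal]

theorem initialIdeal_self (b : Fin r → R) : initialIdeal b r = Ideal.span (Set.range b) := by
  rw [initialIdeal]
  congr 1
  ext y
  simp [eq_comm]

theorem mem_initialIdeal_succ (b : Fin r → R) {k : ℕ} (hk : k < r) {c : R} :
    c ∈ initialIdeal b (k + 1) ↔ ∃ s, ∃ i ∈ initialIdeal b k, c = s * b ⟨k, hk⟩ + i := by
  rw [initialIdeal, initialIdeal, ← Ideal.mem_span_insert]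
  congr! 2
  ext y
  simp only [Set.mem_ofPred_eq, Set.mem_insert_iff, Nat.lt_succ_iff_lt_or_eq]
  constructor
  · rintro ⟨j, hj | rfl, rfl⟩
    · exact Or.inr ⟨j, hj, rfl⟩
    · exact Or.inl rfl
  · rintro (rfl | ⟨j, hj, rfl⟩)
    · exact ⟨⟨k, hk⟩, Or.inr rfl, rfl⟩
    · exact ⟨j, Or.inl hj, rfl⟩

theorem exists_bStar_eq_of_mem_initialIdeal (b : Fin r → R) {k : ℕ} {c : R}
    (hc : c ∈ initialIdeal b k) :
    ∃ u : Fin r → R, (∀ j : Fin r, k ≤ j → u j = 0) ∧ bStar b u = c := by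
  induction hc using Submodule.span_induction with
  | mem c hc =>
    obtain ⟨j, hj, rfl⟩ := hc
    refine ⟨Pi.single j 1, fun i hi => ?_, bStar_single b j⟩
    exact Pi.single_eq_of_ne (by rintro rfl; omega) _
  | zero => exact ⟨0, fun _ _ => rfl, map_zero _⟩
  | add c d _ _ hc hd =>
    obtain ⟨u, hu, rfl⟩ := hc
    obtain ⟨v, hv, rfl⟩ := hd
    exact ⟨u + v, fun j hj => by simp [hu j hj, hv j hj], map_add _ _ _⟩
  | smul s c _ hc =>
    obtain ⟨u, hu, rfl⟩ := hc
    exact ⟨s • u, fun j hj => by simp [hu j hj], map_smul _ _ _⟩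

/-- `x` involves only the first `k` generators. -/
def InvolvesFirst (k : ℕ) (x : ExteriorAlgebra R (Fin r → R)) : Prop :=
  ∀ j : Fin r, k ≤ j → contr (LinearMap.proj j) x = 0

theorem eq_algebraMap_of_involvesFirst_zero {x : ExteriorAlgebra R (Fin r → R)}
    (hx : InvolvesFirst 0 x) : x = algebraMap R _ (ExteriorAlgebra.algebraMapInv x) := by
  have key : ∀ k ≤ r, ∃ g : (Fin r → R) →ₗ[R] (Fin r → R),
      (∀ v (j : Fin r), g v j = if (j : ℕ) < k then 0 else v j) ∧
      ExteriorAlgebra.map g x = x := by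
    intro k
    induction k with
    | zero => exact fun _ => ⟨LinearMap.id, by simp, by simp⟩
    | succ k ih =>
      intro hk
      obtain ⟨g, hg, hgx⟩ := ih (Nat.le_of_succ_le hk)
      refine ⟨(LinearMap.id - (LinearMap.proj (⟨k, hk⟩ : Fin r)).smulRight
        (Pi.single ⟨k, hk⟩ 1)) ∘ₗ g, fun v j => ?_, ?_⟩
      · rcases lt_trichotomy (j : ℕ) k with h | h | h
        · have : j ≠ ⟨k, hk⟩ := fun e => by simp [e] at h
          simp [hg, h, this, Nat.lt_succ_of_lt h]
        · obtain rfl : j = ⟨k, hk⟩ := Fin.ext h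
          simp [hg]
        · have : j ≠ ⟨k, hk⟩ := fun e => by simp [e] at h
          simp [hg, this, h.not_gt, Nat.not_lt.2 (Nat.succ_le_of_lt h)]
      · rw [← ExteriorAlgebra.map_comp_map, AlgHom.comp_apply, hgx, map_sub_smulRight,
          hx _ (Nat.zero_le _), mul_zero, sub_zero]
  obtain ⟨g, hg, hgx⟩ := key r le_rfl
  obtain rfl : g = 0 := LinearMap.ext fun v => funext fun j => by simp [hg]
  rw [← map_zero_eq, hgx]

theorem algebraMapInv_contr_mem (b : Fin r → R) {k : ℕ} {x : ExteriorAlgebra R (Fin r → R)}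
    (hx : InvolvesFirst k x) :
    ExteriorAlgebra.algebraMapInv (contr (bStar b) x) ∈ initialIdeal b k := by
  rw [contr_bStar, map_sum]
  refine sum_mem fun i _ => ?_
  rw [map_smul, smul_eq_mul]
  rcases lt_or_ge (i : ℕ) k with h | h
  · exact Ideal.mul_mem_right _ _ (Ideal.subset_span ⟨i, h, rfl⟩)
  · rw [hx i h, map_zero, mul_zero]
    exact zero_mem _

theorem exists_contr_eq (b : Fin r → R)
    (hreg : ∀ (k : ℕ) (hk : k < r) (c : R), c * b ⟨k, hk⟩ ∈ initialIdeal b k →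
      c ∈ initialIdeal b k)
    (k : ℕ) (hk : k ≤ r) {x : ExteriorAlgebra R (Fin r → R)} (hx : InvolvesFirst k x)
    (hdx : contr (bStar b) x = 0)
    (hε : ExteriorAlgebra.algebraMapInv x ∈ initialIdeal b k) :
    ∃ w, InvolvesFirst k w ∧ contr (bStar b) w = x := by
  induction k generalizing x with
  | zero =>
    refine ⟨0, fun _ _ => map_zero _, ?_⟩
    rw [initialIdeal_zero, Ideal.mem_bot] at hε
    rw [eq_algebraMap_of_involvesFirst_zero hx, hε, map_zero, map_zero]
  | succ k ih =>
    have hk' : k ≤ r := Nat.le_of_succ_le hk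
    set κ : Fin r := ⟨k, hk⟩ with hκ
    set e := ExteriorAlgebra.ι R (Pi.single κ 1 : Fin r → R) with he
    set v := contr (LinearMap.proj κ) x with hv
    have split : ∀ j : Fin r, k ≤ j → j = κ ∨ k + 1 ≤ j := fun j hj => by
      rcases Nat.eq_or_lt_of_le hj with h | h
      · exact Or.inl (Fin.ext h.symm)
      · exact Or.inr h
    have hvA : InvolvesFirst k v := by
      intro j hj
      rcases split j hj with rfl | hj
      · exact contr_contr _ _
      · rw [hv, contr_comm, hx j hj, map_zero, neg_zero]
    have contr_e_mul : ∀ y, InvolvesFirst k y → ∀ j : Fin r, k ≤ j →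
        contr (LinearMap.proj j) (e * y) = if j = κ then y else 0 := by
      intro y hy j hj
      rw [he, contr_ι_mul, hy j hj, mul_zero, sub_zero, LinearMap.proj_apply, Pi.single_apply,
        ite_smul, one_smul, zero_smul]
    set u := x - e * v with hu
    have hxu : x = u + e * v := (sub_add_cancel _ _).symm
    have huA : InvolvesFirst k u := by
      intro j hj
      rw [hu, map_sub, contr_e_mul v hvA j hj]
      rcases split j hj with rfl | hj'
      · rw [if_pos rfl, ← hv, sub_self]
      · rw [hx j hj', if_neg (by rintro rfl; exact absurd hj' (by simp [hκ])), sub_zero]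
    have hdv : contr (bStar b) v = 0 := by rw [hv, contr_comm, hdx, map_zero, neg_zero]
    have hde : ∀ y, contr (bStar b) (e * y) = b κ • y - e * contr (bStar b) y := fun y => by
      rw [he, contr_ι_mul, bStar_single]
    have hdu : contr (bStar b) u = -(b κ • v) := by
      rw [hu, map_sub, hdx, hde, hdv, mul_zero, sub_zero, zero_sub]
    have hεv : ExteriorAlgebra.algebraMapInv v ∈ initialIdeal b k := by
      refine hreg k hk _ ?_
      have := algebraMapInv_contr_mem b huA
      rw [hdu, map_neg, neg_mem_iff, map_smul, smul_eq_mul] at this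
      rwa [mul_comm]
    obtain ⟨w₀, hw₀, hdw₀⟩ := ih hk' hvA hdv hεv
    obtain ⟨s, i, hi, hs⟩ := (mem_initialIdeal_succ b hk).1 hε
    have hεu : ExteriorAlgebra.algebraMapInv u = s * b κ + i := by
      rw [← hs, hu, map_sub, map_mul, he, algebraMapInv_ι, zero_mul, sub_zero]
    set w := w₀ - algebraMap R _ (ExteriorAlgebra.algebraMapInv w₀ + s) with hw
    have hwA : InvolvesFirst k w := fun j hj => by
      rw [hw, map_sub, hw₀ j hj, contr_algebraMap, sub_zero]
    have hdw : contr (bStar b) w = v := by rw [hw, map_sub, hdw₀, contr_algebraMap, sub_zero]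
    have hεw : ExteriorAlgebra.algebraMapInv w = -s := by
      rw [hw, map_sub, ExteriorAlgebra.algebraMap_leftInverse _ _]
      ring
    obtain ⟨z, hz, hdz⟩ := ih hk' (x := u + b κ • w)
      (fun j hj => by rw [map_add, map_smul, huA j hj, hwA j hj, smul_zero, add_zero])
      (by rw [map_add, map_smul, hdu, hdw, neg_add_cancel])
      (by
        rw [map_add, map_smul, hεu, hεw, smul_eq_mul]
        convert hi using 1
        ring)
    refine ⟨z - e * w, fun j hj => ?_, ?_⟩
    · rw [map_sub, hz j (by omega), contr_e_mul w hwA j (by omega),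
        if_neg (by rintro rfl; exact absurd hj (by simp [hκ])), sub_zero]
    · rw [map_sub, hdz, hde, hdw, hxu]
      abel

theorem twistTrivial_of_bStar_eq_zero (b : Fin r → R)
    (hreg : ∀ (k : ℕ) (hk : k < r) (c : R), c * b ⟨k, hk⟩ ∈ initialIdeal b k →
      c ∈ initialIdeal b k)
    (k : ℕ) (hk : k ≤ r) {a : Fin r → R} (ha : ∀ j : Fin r, k ≤ j → a j = 0)
    (hab : bStar b a = 0) : TwistTrivial (bStar b) a := by
  induction k generalizing a with
  | zero =>
    obtain rfl : a = 0 := funext fun j => ha j (Nat.zero_le _)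
    exact TwistTrivial.zero _
  | succ k ih =>
    set κ : Fin r := ⟨k, hk⟩ with hκ
    have hmem : a κ ∈ initialIdeal b k := by
      refine hreg k hk _ ?_
      have h : a κ * b κ = -∑ i ∈ Finset.univ.erase κ, b i * a i := by
        rw [bStar_apply, ← Finset.add_sum_erase _ _ (Finset.mem_univ κ)] at hab
        rw [mul_comm]
        exact eq_neg_of_add_eq_zero_left hab
      rw [h]
      refine neg_mem (sum_mem fun i hi => ?_)
      rcases lt_or_ge (i : ℕ) k with h | h
      · exact Ideal.mul_mem_right _ _ (Ideal.subset_span ⟨i, h, rfl⟩)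
      · have : i ≠ κ := Finset.ne_of_mem_erase hi
        rw [ha i (Nat.lt_of_le_of_ne h fun e => this (Fin.ext e.symm)), mul_zero]
        exact zero_mem _
    obtain ⟨u, hu, hbu⟩ := exists_bStar_eq_of_mem_initialIdeal b hmem
    have key := (ih (Nat.le_of_succ_le hk)
      (a := a - (bStar b u • Pi.single κ 1 - bStar b (Pi.single κ 1) • u)) ?_ ?_).add_koszul
      u (Pi.single κ 1)
    · rwa [sub_add_cancel] at key
    · intro j hj
      rw [hbu]
      by_cases hjκ : j = κ
      · subst hjκ
        simp [hu _ hj]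
      · have : a j = 0 := ha j (Nat.lt_of_le_of_ne hj fun e => hjκ (Fin.ext e.symm))
        simp [hu _ hj, this, hjκ]
    · rw [map_sub, hab, map_sub, map_smul, map_smul, smul_eq_mul, smul_eq_mul]
      ring

end Koszul

/-- for a regular sequence `b₁,…,b_r` and `a` with `∑ aᵢbᵢ = 0`, the regular
Koszul matrix factorization `{a,b}` of `0` satisfies: (1) `D∘D = 0`; (2) `ker D ∩ ⋀^{odd} =
D(⋀^{even})`; (3) the projection `⋀^{even} → ⋀⁰ = R` followed by `R → R/(b₁,…,b_r)` induces
an isomorphism `(ker D ∩ ⋀^{even}) / D(⋀^{odd}) ≅ R/(b₁,…,b_r)` (stated as: the composite is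
surjective on `ker D ∩ ⋀^{even}` and an element maps to `0` iff it lies in `D(⋀^{odd})`). -/
theorem stmt6 {R : Type*} [CommRing R] (r : ℕ) (hr : 1 ≤ r) (b : Fin r → R)
    (hreg : ∀ i : Fin r, ∀ x : R,
      x * b i ∈ Ideal.span {y : R | ∃ j : Fin r, j < i ∧ y = b j} →
      x ∈ Ideal.span {y : R | ∃ j : Fin r, j < i ∧ y = b j})
    (a : Fin r → R) (hab : ∑ i, a i * b i = 0) :
    koszulD a b ∘ₗ koszulD a b = 0 ∧
    {x : ExteriorAlgebra R (Fin r → R) | x ∈ oddPart R r ∧ koszulD a b x = 0}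
      = koszulD a b '' (evenPart R r : Set (ExteriorAlgebra R (Fin r → R))) ∧
    Function.Surjective
      (fun x : ↥(LinearMap.ker (koszulD a b) ⊓ evenPart R r) =>
        Ideal.Quotient.mk (Ideal.span (Set.range b))
          (ExteriorAlgebra.algebraMapInv (x : ExteriorAlgebra R (Fin r → R)))) ∧
    (∀ x : ↥(LinearMap.ker (koszulD a b) ⊓ evenPart R r),
      Ideal.Quotient.mk (Ideal.span (Set.range b))
          (ExteriorAlgebra.algebraMapInv (x : ExteriorAlgebra R (Fin r → R))) = 0 ↔
        ∃ y ∈ oddPart R r, (x : ExteriorAlgebra R (Fin r → R)) = koszulD a b y) := by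
  have hreg' : ∀ (k : ℕ) (hk : k < r) (c : R), c * b ⟨k, hk⟩ ∈ initialIdeal b k →
      c ∈ initialIdeal b k := fun k hk c hc => hreg ⟨k, hk⟩ c hc
  have hba : bStar b a = 0 := by
    rw [bStar_apply, ← hab]
    exact Finset.sum_congr rfl fun i _ => mul_comm _ _
  obtain ⟨E, E', hE, hE', h1, h2, h3, h4⟩ :=
    twistTrivial_of_bStar_eq_zero b hreg' r le_rfl (fun j hj => absurd j.2 hj.not_gt) hba
  have hD : ∀ x, E * koszulD a b x = contr (bStar b) (E * x) := fun x => (h4 x).symm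
  have hcancel : ∀ x, E' * (E * x) = x := fun x => by rw [← mul_assoc, h2, one_mul]
  have hcancel' : ∀ x, E * (E' * x) = x := fun x => by rw [← mul_assoc, h1, one_mul]
  have h3' : ExteriorAlgebra.algebraMapInv E' = 1 := by
    have := congrArg (ExteriorAlgebra.algebraMapInv (R := R) (M := Fin r → R)) h1
    rwa [map_mul, h3, one_mul, map_one] at this
  have hD' : ∀ x, koszulD a b (E' * x) = E' * contr (bStar b) x := fun x => by
    rw [← hcancel (koszulD a b _), hD, hcancel']
  have hDD : ∀ x, koszulD a b (koszulD a b x) = 0 := fun x => by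
    rw [← hcancel (koszulD a b (koszulD a b x)), hD, hD, contr_contr, mul_zero]
  have hpar : ∀ x ∈ evenPart R r, koszulD a b x ∈ oddPart R r := fun x hx =>
    add_mem (ι_mul_mem_parityPart (n := 0) a hx) (contr_mem_parityPart (n := 0) _ hx)
  have hmulE : ∀ {n : ZMod 2} {x z : ExteriorAlgebra R (Fin r → R)},
      z ∈ parityPart R (Fin r → R) 0 → x ∈ parityPart R (Fin r → R) n →
      z * x ∈ parityPart R (Fin r → R) n := fun hz hx => by
    simpa only [zero_add] using mul_mem_parityPart hz hx
  have hexact : ∀ (n : ZMod 2) (x : ExteriorAlgebra R (Fin r → R)),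
      x ∈ parityPart R (Fin r → R) (n + 1) → koszulD a b x = 0 →
      ExteriorAlgebra.algebraMapInv x ∈ Ideal.span (Set.range b) →
      ∃ y ∈ parityPart R (Fin r → R) n, koszulD a b y = x := by
    intro n x hx hDx hεx
    obtain ⟨w, -, hw⟩ := exists_contr_eq b hreg' r le_rfl (x := E * x)
      (fun j hj => absurd j.2 hj.not_gt) (by rw [← hD, hDx, mul_zero])
      (by rwa [map_mul, h3, one_mul, initialIdeal_self])
    obtain ⟨y, hy, hyw⟩ := exists_contr_eq_of_mem_parityPart (bStar b) n (w := w)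
      (hw ▸ hmulE hE hx)
    exact ⟨E' * y, hmulE hE' hy, by rw [hD', hyw, hw, hcancel]⟩
  refine ⟨LinearMap.ext hDD, ?_, ?_, ?_⟩
  · ext x
    constructor
    · rintro ⟨hx, hDx⟩
      exact hexact 0 x hx hDx (algebraMapInv_eq_zero_of_odd hx ▸ zero_mem _)
    · rintro ⟨y, hy, rfl⟩
      exact ⟨hpar y hy, hDD y⟩
  · intro q
    obtain ⟨c, rfl⟩ := Ideal.Quotient.mk_surjective q
    refine ⟨⟨E' * algebraMap R _ c, ?_, hmulE hE' (algebraMap_mem_parityPart c)⟩, ?_⟩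
    · rw [SetLike.mem_coe, LinearMap.mem_ker, hD', contr_algebraMap, mul_zero]
    · change Ideal.Quotient.mk _ (ExteriorAlgebra.algebraMapInv (E' * algebraMap R _ c)) = _
      rw [map_mul, h3', one_mul, ExteriorAlgebra.algebraMap_leftInverse _ c]
  · rintro ⟨x, hDx, hx⟩
    rw [Ideal.Quotient.eq_zero_iff_mem]
    constructor
    · intro hε
      obtain ⟨y, hy, hyx⟩ := hexact 1 x hx hDx hε
      exact ⟨y, hy, hyx.symm⟩
    · rintro ⟨y, -, hyx⟩
      have hyx' : x = koszulD a b y := hyx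
      have hEx : ExteriorAlgebra.algebraMapInv (contr (bStar b) (E * y)) =
          ExteriorAlgebra.algebraMapInv x := by
        rw [← hD, map_mul, h3, one_mul, hyx']
      change ExteriorAlgebra.algebraMapInv x ∈ _
      rw [← hEx, ← initialIdeal_self]
      exact algebraMapInv_contr_mem b fun j hj => absurd j.2 hj.not_gt
end

section
/- Let (E_0,E_1,δ_0^E,δ_1^E) be a matrix factorization of W and (F_0,F_1,δ_0^F,δ_1^F) a matrix factorization of −W over R, where E_0,E_1,F_0,F_1 are finitely generated projective R-modules. Form the 2-periodic tensor product complex with even term T_0 = (E_0⊗F_0)⊕(E_1⊗F_1), odd term T_1 = (E_0⊗F_1)⊕(E_1⊗F_0), and differential D determined on homogeneous elements by D(e⊗f) = δ^E(e)⊗f + (−1)^{|e|}·e⊗δ^F(f); then D∘D = 0. Let M = coker(δ_1^E : E_1 → E_0), which is an R̄-module, and let F̄ be the 2-periodic complex of R̄-modules with even term F_0/W·F_0, odd term F_1/W·F_1, and differentials induced by δ_0^F and δ_1^F. Then the map of 2-periodic complexes q : (T,D) → M ⊗_{R̄} F̄, given on E_0⊗F_0 and on E_0⊗F_1 by the projection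 E_0 ↠ M tensored with reduction modulo W, and by zero on E_1⊗F_1 and E_1⊗F_0, is a chain map and a quasi-isomorphism: it induces isomorphisms on both the even and the odd homology modules ker/im. -/
open TensorProduct

/-- The submodule `W·F ⊆ F`. -/
noncomputable def wSub {R : Type*} [CommRing R] (W : R) (F : Type*) [AddCommGroup F]
    [Module R F] : Submodule R F :=
  LinearMap.range ((W • LinearMap.id) : F →ₗ[R] F)

/-- The map `F/WF → F'/WF'` induced by an `R`-linear map `δ : F → F'`. -/
noncomputable def barMap {R : Type*} [CommRing R] (W : R) {F F' : Type*}
    [AddCommGroup F] [Module R F] [AddCommGroup F'] [Module R F'] (δ : F →ₗ[R] F') :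
    (F ⧸ wSub W F) →ₗ[R] (F' ⧸ wSub W F') :=
  Submodule.mapQ _ _ δ (by
    rintro x ⟨y, rfl⟩
    exact ⟨δ y, by simp⟩)

/-- The differential `id_M ⊗ δ̄ : M ⊗ F/WF → M ⊗ F'/WF'` of the complex `M ⊗ F̄`. -/
noncomputable def idTensorBar {R : Type*} [CommRing R] (W : R) (M : Type*)
    [AddCommGroup M] [Module R M] {F F' : Type*}
    [AddCommGroup F] [Module R F] [AddCommGroup F'] [Module R F'] (δ : F →ₗ[R] F') :
    (M ⊗[R] (F ⧸ wSub W F)) →ₗ[R] (M ⊗[R] (F' ⧸ wSub W F')) :=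
  TensorProduct.map LinearMap.id (barMap W δ)

section TensorComplex

variable {R : Type*} [CommRing R] {E0 E1 F G : Type*}
  [AddCommGroup E0] [Module R E0] [AddCommGroup E1] [Module R E1]
  [AddCommGroup F] [Module R F] [AddCommGroup G] [Module R G]

/-- The differential `(E₀ ⊗ F) ⊕ (E₁ ⊗ G) → (E₀ ⊗ G) ⊕ (E₁ ⊗ F)` of the tensor product of
2-periodic sequences. -/
noncomputable def tensorDiff (δ0 : E0 →ₗ[R] E1) (δ1 : E1 →ₗ[R] E0)
    (f : F →ₗ[R] G) (g : G →ₗ[R] F) :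
    ((E0 ⊗[R] F) × (E1 ⊗[R] G)) →ₗ[R] ((E0 ⊗[R] G) × (E1 ⊗[R] F)) :=
  ((f.lTensor E0).coprod (δ1.rTensor G)).prod ((δ0.rTensor F).coprod (-(g.lTensor E1)))

/-- The map `(E₀ ⊗ F) ⊕ (E₁ ⊗ G) → coker δ₁ ⊗ F/WF`: projection tensored with reduction on the
first summand and zero on the second. -/
noncomputable def tensorProj (W : R) (δ1 : E1 →ₗ[R] E0) (F G : Type*)
    [AddCommGroup F] [Module R F] [AddCommGroup G] [Module R G] :
    ((E0 ⊗[R] F) × (E1 ⊗[R] G)) →ₗ[R] ((E0 ⧸ LinearMap.range δ1) ⊗[R] (F ⧸ wSub W F)) :=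
  TensorProduct.map (LinearMap.range δ1).mkQ (wSub W F).mkQ ∘ₗ LinearMap.fst R _ _

variable {W : R} {δ0 : E0 →ₗ[R] E1} {δ1 : E1 →ₗ[R] E0} {f : F →ₗ[R] G} {g : G →ₗ[R] F}

theorem tensorDiff_apply (a : E0 ⊗[R] F) (b : E1 ⊗[R] G) :
    tensorDiff δ0 δ1 f g (a, b) =
      (f.lTensor E0 a + δ1.rTensor G b, δ0.rTensor F a - g.lTensor E1 b) := by
  simp [tensorDiff, sub_eq_add_neg]

theorem lTensor_lTensor_eq_smul {c : R} (E : Type*) [AddCommGroup E] [Module R E]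
    (h : g ∘ₗ f = c • LinearMap.id) (a : E ⊗[R] F) :
    g.lTensor E (f.lTensor E a) = c • a := by
  rw [← LinearMap.lTensor_comp_apply, h, LinearMap.lTensor_smul]
  simp

theorem rTensor_rTensor_eq_smul {c : R} (E : Type*) [AddCommGroup E] [Module R E]
    (h : g ∘ₗ f = c • LinearMap.id) (a : F ⊗[R] E) :
    g.rTensor E (f.rTensor E a) = c • a := by
  rw [← LinearMap.rTensor_comp_apply, h, LinearMap.rTensor_smul]
  simp

theorem lTensor_rTensor_comm (a : E0 ⊗[R] F) :
    f.lTensor E1 (δ0.rTensor F a) = δ0.rTensor G (f.lTensor E0 a) := by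
  rw [← LinearMap.comp_apply, ← LinearMap.comp_apply, LinearMap.lTensor_comp_rTensor,
    LinearMap.rTensor_comp_lTensor]

theorem tensorDiff_comp_tensorDiff
    (h1 : δ0 ∘ₗ δ1 = W • LinearMap.id) (h0 : δ1 ∘ₗ δ0 = W • LinearMap.id)
    (hfg : f ∘ₗ g = (-W) • LinearMap.id) (hgf : g ∘ₗ f = (-W) • LinearMap.id) :
    tensorDiff δ0 δ1 g f ∘ₗ tensorDiff δ0 δ1 f g = 0 := by
  refine LinearMap.ext fun ⟨a, b⟩ => ?_
  simp only [LinearMap.comp_apply, tensorDiff_apply, map_add, map_sub, LinearMap.zero_apply,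
    lTensor_lTensor_eq_smul _ hgf, lTensor_lTensor_eq_smul _ hfg, rTensor_rTensor_eq_smul _ h0,
    rTensor_rTensor_eq_smul _ h1, lTensor_rTensor_comm]
  ext <;> simp

theorem barMap_comp_barMap (h : g ∘ₗ f = (-W) • LinearMap.id) :
    barMap W g ∘ₗ barMap W f = 0 := by
  refine LinearMap.ext fun x => ?_
  obtain ⟨x, rfl⟩ := Submodule.Quotient.mk_surjective _ x
  have hx : g (f x) = (-W) • x := LinearMap.congr_fun h x
  simp only [barMap, LinearMap.comp_apply, Submodule.mapQ_apply, hx, LinearMap.zero_apply,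
    Submodule.Quotient.mk_eq_zero]
  exact ⟨-x, by simp⟩

theorem idTensorBar_comp_idTensorBar (M : Type*) [AddCommGroup M] [Module R M]
    (h : g ∘ₗ f = (-W) • LinearMap.id) :
    idTensorBar W M g ∘ₗ idTensorBar W M f = 0 := by
  rw [idTensorBar, idTensorBar, ← TensorProduct.map_comp, barMap_comp_barMap h,
    TensorProduct.map_zero_right]

theorem tensorProj_comp_tensorDiff :
    tensorProj W δ1 G F ∘ₗ tensorDiff δ0 δ1 f g =
      idTensorBar W (E0 ⧸ LinearMap.range δ1) f ∘ₗ tensorProj W δ1 F G := by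
  ext x y
  · simp [tensorProj, tensorDiff, idTensorBar, barMap]
  · have hx : (Submodule.Quotient.mk (δ1 x) : E0 ⧸ LinearMap.range δ1) = 0 := by simp
    simp [tensorProj, tensorDiff, hx]

theorem tensorProj_surjective (z : (E0 ⧸ LinearMap.range δ1) ⊗[R] (F ⧸ wSub W F)) :
    ∃ a : E0 ⊗[R] F, tensorProj W δ1 F G (a, 0) = z :=
  TensorProduct.map_surjective (Submodule.mkQ_surjective _) (Submodule.mkQ_surjective _) z

/-- The cokernel of `δ₁` is killed by `W`, so reduction modulo `W` does not enlarge the kernel. -/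
theorem exists_rTensor_eq_of_tensorProj_eq_zero (h0 : δ1 ∘ₗ δ0 = W • LinearMap.id)
    {a : E0 ⊗[R] F} {b : E1 ⊗[R] G} (h : tensorProj W δ1 F G (a, b) = 0) :
    ∃ c : E1 ⊗[R] F, δ1.rTensor F c = a := by
  have hker := TensorProduct.map_ker
    (f := δ1) (g := (LinearMap.range δ1).mkQ)
    (f' := (W • LinearMap.id : F →ₗ[R] F)) (g' := (wSub W F).mkQ)
    (LinearMap.exact_iff.2 (Submodule.ker_mkQ _)) (Submodule.mkQ_surjective _)
    (LinearMap.exact_iff.2 (Submodule.ker_mkQ _)) (Submodule.mkQ_surjective _)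
  have ha : a ∈ LinearMap.ker
      (TensorProduct.map (LinearMap.range δ1).mkQ (wSub W F).mkQ) := h
  rw [hker, Submodule.mem_sup] at ha
  obtain ⟨_, ⟨u, rfl⟩, _, ⟨v, rfl⟩, rfl⟩ := ha
  refine ⟨δ0.rTensor F u + v, ?_⟩
  rw [map_add, rTensor_rTensor_eq_smul _ h0, LinearMap.lTensor_smul]
  simp

theorem rTensor_injective_of_comp_eq_smul [Module.Flat R E1] [Module.Flat R F]
    (hW : ∀ x : R, W * x = 0 → x = 0) (h1 : δ0 ∘ₗ δ1 = W • LinearMap.id) :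
    Function.Injective (δ1.rTensor F) := by
  have hreg : IsSMulRegular (E1 ⊗[R] F) W :=
    Module.Flat.isSMulRegular_of_nonZeroDivisors
      (mem_nonZeroDivisors_iff_left.2 hW)
  intro a b hab
  apply hreg
  simpa only [rTensor_rTensor_eq_smul _ h1] using congrArg (δ0.rTensor F) hab

/-- Surjectivity of the projection on homology. -/
theorem exists_tensorProj_sub_eq [Module.Flat R E1] [Module.Flat R F]
    (hW : ∀ x : R, W * x = 0 → x = 0)
    (h1 : δ0 ∘ₗ δ1 = W • LinearMap.id) (h0 : δ1 ∘ₗ δ0 = W • LinearMap.id)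
    (hgf : g ∘ₗ f = (-W) • LinearMap.id)
    (z : (E0 ⧸ LinearMap.range δ1) ⊗[R] (F ⧸ wSub W F))
    (hz : idTensorBar W (E0 ⧸ LinearMap.range δ1) f z = 0) :
    ∃ x, tensorDiff δ0 δ1 f g x = 0 ∧
      ∃ y, tensorProj W δ1 F G x - z = idTensorBar W (E0 ⧸ LinearMap.range δ1) g y := by
  obtain ⟨a, rfl⟩ := tensorProj_surjective (G := G) z
  rw [← LinearMap.comp_apply, ← tensorProj_comp_tensorDiff (δ0 := δ0) (g := g),
    LinearMap.comp_apply, tensorDiff_apply] at hz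
  obtain ⟨c, hc⟩ := exists_rTensor_eq_of_tensorProj_eq_zero h0 hz
  rw [map_zero, add_zero] at hc
  refine ⟨(a, -c), ?_, 0, ?_⟩
  · rw [tensorDiff_apply, map_neg, map_neg, hc, add_neg_cancel, sub_neg_eq_add, Prod.mk_eq_zero]
    refine ⟨rfl, rTensor_injective_of_comp_eq_smul (F := F) hW h1 ?_⟩
    rw [map_add, rTensor_rTensor_eq_smul _ h0, ← lTensor_rTensor_comm, hc,
      lTensor_lTensor_eq_smul _ hgf, map_zero, neg_smul, add_neg_cancel]
  · rw [map_zero, sub_eq_zero]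
    rfl

/-- Injectivity of the projection on homology. -/
theorem exists_eq_tensorDiff [Module.Flat R E1] [Module.Flat R G]
    (hW : ∀ x : R, W * x = 0 → x = 0)
    (h1 : δ0 ∘ₗ δ1 = W • LinearMap.id) (h0 : δ1 ∘ₗ δ0 = W • LinearMap.id)
    (hfg : f ∘ₗ g = (-W) • LinearMap.id) (hgf : g ∘ₗ f = (-W) • LinearMap.id)
    (x : (E0 ⊗[R] F) × (E1 ⊗[R] G)) (hx : tensorDiff δ0 δ1 f g x = 0)
    (hq : ∃ y, tensorProj W δ1 F G x = idTensorBar W (E0 ⧸ LinearMap.range δ1) g y) :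
    ∃ t, x = tensorDiff δ0 δ1 g f t := by
  obtain ⟨y, hy⟩ := hq
  obtain ⟨a', rfl⟩ := tensorProj_surjective (G := F) y
  rw [← LinearMap.comp_apply, ← tensorProj_comp_tensorDiff (δ0 := δ0) (g := f),
    LinearMap.comp_apply, ← sub_eq_zero, ← map_sub] at hy
  obtain ⟨c, hc⟩ := exists_rTensor_eq_of_tensorProj_eq_zero h0 hy
  refine ⟨(a', c), ?_⟩
  have hcycle : tensorDiff δ0 δ1 f g (x - tensorDiff δ0 δ1 g f (a', c)) = 0 := by
    rw [map_sub, hx, ← LinearMap.comp_apply (tensorDiff δ0 δ1 f g),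
      tensorDiff_comp_tensorDiff h1 h0 hgf hfg, LinearMap.zero_apply, sub_zero]
  have hfst : (x - tensorDiff δ0 δ1 g f (a', c)).1 = 0 := by
    simp only [tensorDiff_apply, map_zero, add_zero, Prod.fst_sub] at hc ⊢
    rw [hc]
    abel
  rw [← sub_eq_zero]
  generalize x - tensorDiff δ0 δ1 g f (a', c) = w at hcycle hfst
  obtain ⟨_, b⟩ := w
  obtain rfl := hfst
  rw [tensorDiff_apply, map_zero, zero_add] at hcycle
  rw [Prod.mk_eq_zero]
  refine ⟨rfl, rTensor_injective_of_comp_eq_smul (F := G) hW h1 ?_⟩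
  rw [map_zero]
  exact congrArg Prod.fst hcycle

end TensorComplex

/-- the 2-periodic tensor-product complex of a matrix factorization of `W` and a
matrix factorization of `−W` (with the Leibniz-rule differential) maps quasi-isomorphically
onto `M ⊗ F̄`, where `M = coker(δ₁^E)` and `F̄ = F/WF`, via projection ⊗ reduction on
`E₀⊗F₀`, `E₀⊗F₁` and zero on the other summands. -/
theorem stmt8 {R : Type*} [CommRing R] (W : R) (hW : ∀ x : R, W * x = 0 → x = 0)
    {E0 E1 F0 F1 : Type*}
    [AddCommGroup E0] [Module R E0] [Module.Finite R E0] [Module.Projective R E0]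
    [AddCommGroup E1] [Module R E1] [Module.Finite R E1] [Module.Projective R E1]
    [AddCommGroup F0] [Module R F0] [Module.Finite R F0] [Module.Projective R F0]
    [AddCommGroup F1] [Module R F1] [Module.Finite R F1] [Module.Projective R F1]
    (δ0E : E0 →ₗ[R] E1) (δ1E : E1 →ₗ[R] E0)
    (hE1 : δ0E ∘ₗ δ1E = W • LinearMap.id) (hE0 : δ1E ∘ₗ δ0E = W • LinearMap.id)
    (δ0F : F0 →ₗ[R] F1) (δ1F : F1 →ₗ[R] F0)
    (hF1 : δ0F ∘ₗ δ1F = (-W) • LinearMap.id) (hF0 : δ1F ∘ₗ δ0F = (-W) • LinearMap.id) :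
    ∃ (Dev : ((E0 ⊗[R] F0) × (E1 ⊗[R] F1)) →ₗ[R] ((E0 ⊗[R] F1) × (E1 ⊗[R] F0)))
      (Dod : ((E0 ⊗[R] F1) × (E1 ⊗[R] F0)) →ₗ[R] ((E0 ⊗[R] F0) × (E1 ⊗[R] F1)))
      (qEv : ((E0 ⊗[R] F0) × (E1 ⊗[R] F1)) →ₗ[R]
          ((E0 ⧸ LinearMap.range δ1E) ⊗[R] (F0 ⧸ wSub W F0)))
      (qOd : ((E0 ⊗[R] F1) × (E1 ⊗[R] F0)) →ₗ[R]
          ((E0 ⧸ LinearMap.range δ1E) ⊗[R] (F1 ⧸ wSub W F1))),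
      -- the differential is given on homogeneous elements by the Leibniz rule
      (∀ (x : E0) (y : F0), Dev (x ⊗ₜ[R] y, 0) = (x ⊗ₜ[R] δ0F y, δ0E x ⊗ₜ[R] y)) ∧
      (∀ (x : E1) (y : F1), Dev (0, x ⊗ₜ[R] y) = (δ1E x ⊗ₜ[R] y, -(x ⊗ₜ[R] δ1F y))) ∧
      (∀ (x : E0) (y : F1), Dod (x ⊗ₜ[R] y, 0) = (x ⊗ₜ[R] δ1F y, δ0E x ⊗ₜ[R] y)) ∧
      (∀ (x : E1) (y : F0), Dod (0, x ⊗ₜ[R] y) = (δ1E x ⊗ₜ[R] y, -(x ⊗ₜ[R] δ0F y))) ∧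
      -- the chain map q: projection ⊗ reduction on E0 ⊗ F0 and E0 ⊗ F1, zero elsewhere
      (∀ (x : E0) (y : F0), qEv (x ⊗ₜ[R] y, 0)
          = Submodule.Quotient.mk x ⊗ₜ[R] Submodule.Quotient.mk y) ∧
      (∀ z : E1 ⊗[R] F1, qEv (0, z) = 0) ∧
      (∀ (x : E0) (y : F1), qOd (x ⊗ₜ[R] y, 0)
          = Submodule.Quotient.mk x ⊗ₜ[R] Submodule.Quotient.mk y) ∧
      (∀ z : E1 ⊗[R] F0, qOd (0, z) = 0) ∧
      -- both sides are 2-periodic complexes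
      Dod ∘ₗ Dev = 0 ∧ Dev ∘ₗ Dod = 0 ∧
      idTensorBar W (E0 ⧸ LinearMap.range δ1E) δ1F ∘ₗ
          idTensorBar W (E0 ⧸ LinearMap.range δ1E) δ0F = 0 ∧
      idTensorBar W (E0 ⧸ LinearMap.range δ1E) δ0F ∘ₗ
          idTensorBar W (E0 ⧸ LinearMap.range δ1E) δ1F = 0 ∧
      -- q is a chain map
      qOd ∘ₗ Dev = idTensorBar W (E0 ⧸ LinearMap.range δ1E) δ0F ∘ₗ qEv ∧
      qEv ∘ₗ Dod = idTensorBar W (E0 ⧸ LinearMap.range δ1E) δ1F ∘ₗ qOd ∧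
      -- q induces an isomorphism on even homology
      (∀ z : (E0 ⧸ LinearMap.range δ1E) ⊗[R] (F0 ⧸ wSub W F0),
        idTensorBar W (E0 ⧸ LinearMap.range δ1E) δ0F z = 0 →
          ∃ x, Dev x = 0 ∧
            ∃ y, qEv x - z = idTensorBar W (E0 ⧸ LinearMap.range δ1E) δ1F y) ∧
      (∀ x, Dev x = 0 →
        (∃ y, qEv x = idTensorBar W (E0 ⧸ LinearMap.range δ1E) δ1F y) →
          ∃ t, x = Dod t) ∧
      -- q induces an isomorphism on odd homology
      (∀ z : (E0 ⧸ LinearMap.range δ1E) ⊗[R] (F1 ⧸ wSub W F1),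
        idTensorBar W (E0 ⧸ LinearMap.range δ1E) δ1F z = 0 →
          ∃ x, Dod x = 0 ∧
            ∃ y, qOd x - z = idTensorBar W (E0 ⧸ LinearMap.range δ1E) δ0F y) ∧
      (∀ x, Dod x = 0 →
        (∃ y, qOd x = idTensorBar W (E0 ⧸ LinearMap.range δ1E) δ0F y) →
          ∃ t, x = Dev t) := by
  refine ⟨tensorDiff δ0E δ1E δ0F δ1F, tensorDiff δ0E δ1E δ1F δ0F,
    tensorProj W δ1E F0 F1, tensorProj W δ1E F1 F0,
    fun x y => by simp [tensorDiff], fun x y => by simp [tensorDiff],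
    fun x y => by simp [tensorDiff], fun x y => by simp [tensorDiff],
    fun _ _ => rfl, fun _ => by simp [tensorProj],
    fun _ _ => rfl, fun _ => by simp [tensorProj],
    tensorDiff_comp_tensorDiff hE1 hE0 hF1 hF0, tensorDiff_comp_tensorDiff hE1 hE0 hF0 hF1,
    idTensorBar_comp_idTensorBar _ hF0, idTensorBar_comp_idTensorBar _ hF1,
    tensorProj_comp_tensorDiff, tensorProj_comp_tensorDiff,
    exists_tensorProj_sub_eq hW hE1 hE0 hF0, exists_eq_tensorDiff hW hE1 hE0 hF1 hF0,
    exists_tensorProj_sub_eq hW hE1 hE0 hF1, exists_eq_tensorDiff hW hE1 hE0 hF0 hF1⟩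
end

section
/- Let (P_0,P_1,δ_0,δ_1) be a matrix factorization of W_1 ∈ R over R, and let f, g ∈ R with W = f·g. Assume: (a) multiplication by W+W_1 is injective on P_0 and on P_1; (b) multiplication by f is injective on P_0; (c) for every p_1 ∈ P_1, if δ_1(p_1) ∈ f·P_0 then p_1 ∈ f·P_1. Define the R-linear map D : P_1⊕P_0 → P_0⊕P_1 by D(p_1,p_0) = (δ_1(p_1) + f·p_0, δ_0(p_0) − g·p_1). Then D is injective and there is a short exact sequence of R-modules 0 → P_1/(W+W_1)·P_1 → coker(D) → P_0/(δ_1(P_1) + f·P_0) → 0, in which the first map is induced by p_1 ↦ (0,p_1) ∈ P_0⊕P_1 and the second map is induced by the projection P_0⊕P_1 → P_0. -/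
/-- for a matrix factorization `(P₀,P₁,δ₀,δ₁)` of `W₁` and `W = f·g`, under the
stated injectivity hypotheses, the map `D(p₁,p₀) = (δ₁p₁ + f·p₀, δ₀p₀ − g·p₁)` is injective
and there is a short exact sequence
`0 → P₁/(W+W₁)P₁ → coker D → P₀/(δ₁(P₁) + f·P₀) → 0`,
with the first map induced by `p₁ ↦ (0,p₁)` and the second induced by the projection. -/
theorem stmt9 {R : Type*} [CommRing R] {P0 P1 : Type*}
    [AddCommGroup P0] [Module R P0] [AddCommGroup P1] [Module R P1]
    (W1 : R) (δ0 : P0 →ₗ[R] P1) (δ1 : P1 →ₗ[R] P0)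
    (hδ01 : δ0 ∘ₗ δ1 = W1 • LinearMap.id) (hδ10 : δ1 ∘ₗ δ0 = W1 • LinearMap.id)
    (f g W : R) (hW : W = f * g)
    (ha0 : ∀ x : P0, (W + W1) • x = 0 → x = 0)
    (ha1 : ∀ x : P1, (W + W1) • x = 0 → x = 0)
    (hb : ∀ x : P0, f • x = 0 → x = 0)
    (hc : ∀ p1 : P1, (∃ p0 : P0, δ1 p1 = f • p0) → ∃ p1' : P1, p1 = f • p1') :
    ∃ D : (P1 × P0) →ₗ[R] (P0 × P1),
      (∀ (p1 : P1) (p0 : P0), D (p1, p0) = (δ1 p1 + f • p0, δ0 p0 - g • p1)) ∧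
      Function.Injective D ∧
      ∃ (α : (P1 ⧸ LinearMap.range ((W + W1) • (LinearMap.id : P1 →ₗ[R] P1))) →ₗ[R]
            ((P0 × P1) ⧸ LinearMap.range D))
        (β : ((P0 × P1) ⧸ LinearMap.range D) →ₗ[R]
            (P0 ⧸ (LinearMap.range δ1 ⊔
              LinearMap.range (f • (LinearMap.id : P0 →ₗ[R] P0))))),
        (∀ p1 : P1, α (Submodule.Quotient.mk p1)
            = Submodule.Quotient.mk ((0 : P0), p1)) ∧
        (∀ x : P0 × P1, β (Submodule.Quotient.mk x) = Submodule.Quotient.mk x.1) ∧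
        Function.Injective α ∧ Function.Surjective β ∧
        LinearMap.ker β = LinearMap.range α := by
  have h01 (x : P1) : δ0 (δ1 x) = W1 • x := by simpa using LinearMap.congr_fun hδ01 x
  subst hW
  let D : (P1 × P0) →ₗ[R] (P0 × P1) :=
    (δ1.coprod (f • LinearMap.id)).prod ((-(g • LinearMap.id)).coprod δ0)
  have hD (p1 : P1) (p0 : P0) : D (p1, p0) = (δ1 p1 + f • p0, δ0 p0 - g • p1) := by
    simp [D, sub_eq_add_neg, add_comm]
  have hα : LinearMap.range ((f * g + W1) • (LinearMap.id : P1 →ₗ[R] P1)) ≤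
      (LinearMap.range D).comap (LinearMap.inr R P0 P1) := by
    rintro _ ⟨x, rfl⟩
    refine ⟨(-(f • x), δ1 x), ?_⟩
    rw [hD]
    ext
    · simp
    · simp only [h01, LinearMap.inr_apply, LinearMap.smul_apply, LinearMap.id_apply]
      module
  have hβ : LinearMap.range D ≤ (LinearMap.range δ1 ⊔
      LinearMap.range (f • (LinearMap.id : P0 →ₗ[R] P0))).comap (LinearMap.fst R P0 P1) := by
    rintro _ ⟨⟨a, b⟩, rfl⟩
    rw [hD]
    exact Submodule.add_mem_sup ⟨a, rfl⟩ ⟨b, rfl⟩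
  refine ⟨D, hD, ?_, Submodule.mapQ _ _ (LinearMap.inr R P0 P1) hα,
    Submodule.mapQ _ _ (LinearMap.fst R P0 P1) hβ, fun _ => rfl, fun _ => rfl, ?_, ?_, ?_⟩
  · rw [injective_iff_map_eq_zero]
    rintro ⟨a, b⟩ h
    rw [hD, Prod.mk_eq_zero] at h
    obtain ⟨h1, h2⟩ := h
    have ha : a = 0 := by
      apply ha1
      have h3 := congrArg δ0 h1
      rw [map_add, map_smul, map_zero, h01, sub_eq_zero.mp h2] at h3
      rw [← h3]
      module
    subst ha
    rw [map_zero, zero_add] at h1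
    rw [hb b h1, Prod.mk_zero_zero]
  · rw [injective_iff_map_eq_zero]
    intro q hq
    obtain ⟨p, rfl⟩ := Submodule.Quotient.mk_surjective _ q
    rw [Submodule.mapQ_apply, Submodule.Quotient.mk_eq_zero] at hq
    obtain ⟨⟨a, b⟩, h⟩ := hq
    rw [hD, LinearMap.inr_apply, Prod.mk.injEq] at h
    obtain ⟨h1, h2⟩ := h
    obtain ⟨c, rfl⟩ := hc a ⟨-b, by rw [smul_neg]; exact eq_neg_of_add_eq_zero_left h1⟩
    have h3 : δ1 c + b = 0 := hb _ (by rw [smul_add, ← map_smul, h1])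
    rw [Submodule.Quotient.mk_eq_zero]
    refine ⟨-c, ?_⟩
    rw [← h2, eq_neg_of_add_eq_zero_right h3, map_neg, map_neg, h01]
    simp only [LinearMap.smul_apply, LinearMap.id_apply]
    module
  · intro q
    obtain ⟨p, rfl⟩ := Submodule.Quotient.mk_surjective _ q
    exact ⟨Submodule.Quotient.mk (p, 0), rfl⟩
  · apply le_antisymm
    · intro q hq
      obtain ⟨⟨x, y⟩, rfl⟩ := Submodule.Quotient.mk_surjective _ q
      rw [LinearMap.mem_ker, Submodule.mapQ_apply, Submodule.Quotient.mk_eq_zero] at hq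
      obtain ⟨_, ⟨a, rfl⟩, _, ⟨b, rfl⟩, h⟩ := Submodule.mem_sup.mp hq
      simp only [LinearMap.smul_apply, LinearMap.id_apply, LinearMap.fst_apply] at h
      refine ⟨Submodule.Quotient.mk (y - (δ0 b - g • a)), ?_⟩
      rw [Submodule.mapQ_apply, Submodule.Quotient.eq]
      refine ⟨(-a, -b), ?_⟩
      rw [hD, ← h]
      ext
      · simp [add_comm]
      · simp only [LinearMap.inr_apply, Prod.snd_sub, map_neg]
        module
    · rintro _ ⟨q, rfl⟩
      obtain ⟨p, rfl⟩ := Submodule.Quotient.mk_surjective _ q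
      rw [LinearMap.mem_ker, Submodule.mapQ_apply, Submodule.mapQ_apply, LinearMap.inr_apply,
        LinearMap.fst_apply, Submodule.Quotient.mk_zero]
end

section
/- Under the stated hypotheses, the dimension of A satisfies dim_ℂ(A) · (w_1·w_2·⋯·w_N) = e_1·e_2·⋯·e_N. (This is the algebraic form of the index-zero degree formula: the length of the scheme-theoretic fiber over 0 of a quasihomogeneous map with isolated zero equals the product of the degrees of its components divided by the product of the weights of the variables.) -/
namespace WeightedCompleteIntersection

open MvPolynomial

attribute [local instance] MvPolynomial.weightedGradedAlgebra

variable {σ K : Type*} [Field K] {w : σ → ℕ}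

/-- `I` is homogeneous for the grading of the polynomial ring given by the weights `w`. -/
abbrev IsHomog (w : σ → ℕ) (I : Ideal (MvPolynomial σ K)) : Prop :=
  I.IsHomogeneous (weightedHomogeneousSubmodule K w)

theorem component_mul_of_le {a : MvPolynomial σ K} {d n : ℕ} (ha : a.IsWeightedHomogeneous w d)
    (h : d ≤ n) (b : MvPolynomial σ K) :
    weightedHomogeneousComponent w n (a * b) = a * weightedHomogeneousComponent w (n - d) b := by
  simp_rw [← weightedDecomposition.decompose'_apply]
  exact DirectSum.coe_decompose_mul_of_left_mem_of_le (weightedHomogeneousSubmodule K w)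
    (b := b) ha h

theorem component_mul_of_lt {a : MvPolynomial σ K} {d n : ℕ} (ha : a.IsWeightedHomogeneous w d)
    (h : n < d) (b : MvPolynomial σ K) :
    weightedHomogeneousComponent w n (a * b) = 0 := by
  simp_rw [← weightedDecomposition.decompose'_apply]
  exact DirectSum.coe_decompose_mul_of_left_mem_of_not_le (weightedHomogeneousSubmodule K w)
      (b := b) ha h.not_ge

theorem IsHomog.sup_span {I : Ideal (MvPolynomial σ K)} (hI : IsHomog w I)
    {a : MvPolynomial σ K} {d : ℕ} (ha : a.IsWeightedHomogeneous w d) :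
    IsHomog w (I ⊔ Ideal.span {a}) :=
  Ideal.IsHomogeneous.sup hI (Ideal.homogeneous_span _ _ (by rintro _ rfl; exact ⟨d, ha⟩))

theorem IsHomog.component_mem {I : Ideal (MvPolynomial σ K)} (hI : IsHomog w I)
    {p : MvPolynomial σ K} (hp : p ∈ I) (n : ℕ) : weightedHomogeneousComponent w n p ∈ I :=
  weightedHomogeneousComponent_mem_of_mem K w hI hp n

/-- The element `a` is a nonzerodivisor modulo `I`. -/
def RegularMod {R : Type*} [CommRing R] (I : Ideal R) (a : R) : Prop := ∀ r, a * r ∈ I → r ∈ I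

/-- The list `l` is a weakly regular sequence modulo `I`. -/
def RegularSeqMod {R : Type*} [CommRing R] : Ideal R → List R → Prop
  | _, [] => True
  | I, a :: l => RegularMod I a ∧ RegularSeqMod (I ⊔ Ideal.span {a}) l

theorem RegularMod.of_pow_mem {R : Type*} [CommRing R] {I : Ideal R} {x b : R}
    (hx : RegularMod I x) (h : x ∈ (I ⊔ Ideal.span {b}).radical) : RegularMod I b := by
  intro r hr
  obtain ⟨k, hk⟩ := h
  obtain ⟨c, hc⟩ : ∃ c, x ^ k - c * b ∈ I := by
    obtain ⟨i, hi, j, hj, hij⟩ := Submodule.mem_sup.mp hk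
    obtain ⟨c, rfl⟩ := Ideal.mem_span_singleton'.mp hj
    exact ⟨c, by rwa [← hij, add_sub_cancel_right]⟩
  have key : x ^ k * r ∈ I := by
    have := I.add_mem (I.mul_mem_right r hc) (I.mul_mem_left c hr)
    convert this using 1; ring
  clear hk hc
  induction k with
  | zero => simpa using key
  | succ k ih => exact ih (hx _ (by rwa [pow_succ', mul_assoc] at key))

theorem RegularMod.swap_right {R : Type*} [CommRing R] {I : Ideal R} {a b : R}
    (ha : RegularMod I a) (hb : RegularMod (I ⊔ Ideal.span {a}) b) :
    RegularMod (I ⊔ Ideal.span {b}) a := by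
  intro r hr
  obtain ⟨i, hi, j, hj, hij⟩ := Submodule.mem_sup.mp hr
  obtain ⟨s, rfl⟩ := Ideal.mem_span_singleton'.mp hj
  have hs : b * s ∈ I ⊔ Ideal.span {a} := by
    have : b * s = -i + r * a := by linear_combination hij
    rw [this]
    exact add_mem (Ideal.mem_sup_left (I.neg_mem hi))
      (Ideal.mem_sup_right (Ideal.mem_span_singleton'.mpr ⟨r, rfl⟩))
  obtain ⟨i', hi', j', hj', hij'⟩ := Submodule.mem_sup.mp (hb s hs)
  obtain ⟨u, rfl⟩ := Ideal.mem_span_singleton'.mp hj'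
  have hr' : r - u * b ∈ I := by
    refine ha _ ?_
    have : a * (r - u * b) = i + b * i' := by linear_combination (-1) * hij - b * hij'
    rw [this]
    exact I.add_mem hi (I.mul_mem_left _ hi')
  have := add_mem (Ideal.mem_sup_left (T := Ideal.span {b}) hr')
    (Ideal.mem_sup_right (Ideal.mem_span_singleton'.mpr ⟨u, rfl⟩))
  simpa using this

theorem mem_of_forall_mem_sup_span_pow {I : Ideal (MvPolynomial σ K)} (hI : IsHomog w I)
    {a : MvPolynomial σ K} {d : ℕ} (hd : 0 < d) (ha : a.IsWeightedHomogeneous w d)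
    {r : MvPolynomial σ K} (hr : ∀ n : ℕ, r ∈ I ⊔ Ideal.span {a ^ n}) : r ∈ I := by
  rw [mem_iff_weightedHomogeneousComponent_mem K w hI]
  intro k
  obtain ⟨i, hi, j, hj, rfl⟩ := Submodule.mem_sup.mp (hr (k + 1))
  obtain ⟨s, rfl⟩ := Ideal.mem_span_singleton'.mp hj
  have hlt : k < (k + 1) • d := by
    rw [smul_eq_mul]; nlinarith
  rw [map_add, mul_comm s, component_mul_of_lt (ha.pow (k + 1)) hlt, add_zero]
  exact hI.component_mem hi k

theorem RegularMod.swap_left {I : Ideal (MvPolynomial σ K)} (hI : IsHomog w I)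
    {a b : MvPolynomial σ K} {d : ℕ} (hd : 0 < d) (hda : a.IsWeightedHomogeneous w d)
    (ha : RegularMod I a) (hb : RegularMod (I ⊔ Ideal.span {a}) b) : RegularMod I b := by
  have key : ∀ (n : ℕ) (r), b * r ∈ I → r ∈ I ⊔ Ideal.span {a ^ n} := by
    intro n
    induction n with
    | zero => simp
    | succ n ih =>
      intro r hr
      obtain ⟨i, hi, j, hj, rfl⟩ := Submodule.mem_sup.mp (hb r (Ideal.mem_sup_left hr))
      obtain ⟨u, rfl⟩ := Ideal.mem_span_singleton'.mp hj
      have hu : b * u ∈ I := by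
        refine ha _ ?_
        have : a * (b * u) = b * (i + u * a) - b * i := by ring
        rw [this]
        exact I.sub_mem hr (I.mul_mem_left _ hi)
      obtain ⟨i', hi', j', hj', rfl⟩ := Submodule.mem_sup.mp (ih u hu)
      obtain ⟨v, rfl⟩ := Ideal.mem_span_singleton'.mp hj'
      have : i + (i' + v * a ^ n) * a = (i + a * i') + v * a ^ (n + 1) := by ring
      rw [this]
      exact add_mem (Ideal.mem_sup_left (I.add_mem hi (I.mul_mem_left _ hi')))
        (Ideal.mem_sup_right (Ideal.mem_span_singleton'.mpr ⟨v, rfl⟩))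
  exact fun r hr ↦ mem_of_forall_mem_sup_span_pow hI hd hda fun n ↦ key n r hr

/-- Every member of `l` is weighted homogeneous of positive degree. -/
def AllHomog (w : σ → ℕ) (l : List (MvPolynomial σ K)) : Prop :=
  ∀ a ∈ l, ∃ d, 0 < d ∧ a.IsWeightedHomogeneous w d

theorem regularSeqMod_cons_iff {l : List (MvPolynomial σ K)} (hl : AllHomog w l)
    {I : Ideal (MvPolynomial σ K)} (hI : IsHomog w I) {a : MvPolynomial σ K} {d : ℕ} (hd : 0 < d)
    (hda : a.IsWeightedHomogeneous w d) :
    RegularSeqMod I (a :: l) ↔ RegularSeqMod I l ∧ RegularMod (I ⊔ Ideal.ofList l) a := by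
  induction l generalizing I with
  | nil => simp [RegularSeqMod]
  | cons b l ih =>
    obtain ⟨e, he, hb⟩ := hl b (by simp)
    have ih' := ih (fun c hc ↦ hl c (by simp [hc])) (hI.sup_span hb)
    rw [Ideal.ofList_cons, ← sup_assoc]
    simp only [RegularSeqMod] at ih' ⊢
    rw [and_assoc, ← ih', sup_right_comm]
    constructor
    · rintro ⟨h1, h2, h3⟩
      exact ⟨h1.swap_left hI hd hda h2, h1.swap_right h2, h3⟩
    · rintro ⟨h1, h2, h3⟩
      exact ⟨h1.swap_left hI he hb h2, h1.swap_right h2, h3⟩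

/-- The radical of `I` contains all the variables. -/
def VarsNilpotent (I : Ideal (MvPolynomial σ K)) : Prop := ∀ i, X i ∈ I.radical

theorem VarsNilpotent.mem_radical {I : Ideal (MvPolynomial σ K)} (hI : VarsNilpotent I)
    {a : MvPolynomial σ K} {d : ℕ} (hd : 0 < d) (ha : a.IsWeightedHomogeneous w d) :
    a ∈ I.radical := by
  rw [a.as_sum]
  refine sum_mem fun m hm ↦ ?_
  have hwm := ha (mem_support_iff.mp hm)
  obtain ⟨i, hi⟩ : ∃ i, m i ≠ 0 := by
    by_contra! h
    have : m = 0 := Finsupp.ext h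
    simp [this] at hwm
    omega
  have : X i ∣ monomial m (coeff m a) := by
    rw [X_dvd_monomial]; exact Or.inr hi
  exact Ideal.mem_of_dvd _ this (hI i)

theorem VarsNilpotent.of_mem_radical {I J : Ideal (MvPolynomial σ K)} {x : MvPolynomial σ K}
    (h : VarsNilpotent (I ⊔ Ideal.span {x})) (hIJ : I ≤ J) (hx : x ∈ J.radical) :
    VarsNilpotent J := fun i ↦
  Ideal.radical_le_radical_iff.mpr
    (sup_le (hIJ.trans Ideal.le_radical) ((Ideal.span_singleton_le_iff_mem _).mpr hx)) (h i)

/-- The image in the quotient by `I` of the weighted homogeneous polynomials of degree `n`. -/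
noncomputable def gradedPiece (w : σ → ℕ) (I : Ideal (MvPolynomial σ K)) (n : ℕ) :
    Submodule K (MvPolynomial σ K ⧸ I) :=
  (weightedHomogeneousSubmodule K w n).map (Ideal.Quotient.mkₐ K I).toLinearMap

/-- The Hilbert function of the quotient by `I`. -/
noncomputable def hilbertFun (w : σ → ℕ) (I : Ideal (MvPolynomial σ K)) (n : ℕ) : ℕ :=
  Module.finrank K (gradedPiece w I n)

theorem finite_gradedPiece [Finite σ] (hw : ∀ i, 0 < w i) (I : Ideal (MvPolynomial σ K)) (n : ℕ) :
    Module.Finite K (gradedPiece w I n) := by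
  have := Module.Finite.iff_fg.mpr
    (weightedHomogeneousSubmodule_fg (R := K) w (fun i ↦ (hw i).ne') n)
  unfold gradedPiece
  infer_instance

/-- The projection between graded pieces of quotients. -/
noncomputable def pieceMap (w : σ → ℕ) {I J : Ideal (MvPolynomial σ K)} (h : I ≤ J) (n : ℕ) :
    gradedPiece w I n →ₗ[K] MvPolynomial σ K ⧸ J :=
  (Ideal.Quotient.factorₐ K h).toLinearMap.domRestrict (gradedPiece w I n)

theorem range_pieceMap {I J : Ideal (MvPolynomial σ K)} (h : I ≤ J) (n : ℕ) :
    LinearMap.range (pieceMap w h n) = gradedPiece w J n := by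
  rw [pieceMap, LinearMap.range_domRestrict, gradedPiece, gradedPiece, ← Submodule.map_comp]
  rfl

theorem finrank_ker_add [Finite σ] (hw : ∀ i, 0 < w i) {I J : Ideal (MvPolynomial σ K)}
    (h : I ≤ J) (n : ℕ) :
    hilbertFun w J n + Module.finrank K (LinearMap.ker (pieceMap w h n)) = hilbertFun w I n := by
  have := finite_gradedPiece hw I n
  rw [hilbertFun, hilbertFun, ← range_pieceMap h n, LinearMap.finrank_range_add_finrank_ker]

theorem map_subtype_ker_pieceMap {I : Ideal (MvPolynomial σ K)} (hI : IsHomog w I)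
    {b : MvPolynomial σ K} {d n : ℕ} (hb : b.IsWeightedHomogeneous w d) (hdn : d ≤ n) :
    (LinearMap.ker (pieceMap w (le_sup_left : I ≤ I ⊔ Ideal.span {b}) n)).map
        (gradedPiece w I n).subtype =
      (gradedPiece w I (n - d)).map (LinearMap.mulLeft K (Ideal.Quotient.mk I b)) := by
  ext q
  constructor
  · rintro ⟨⟨_, p, hp, rfl⟩, hq, rfl⟩
    have hmem : p ∈ I ⊔ Ideal.span {b} := Ideal.Quotient.eq_zero_iff_mem.mp hq
    obtain ⟨i, hi, j, hj, rfl⟩ := Submodule.mem_sup.mp hmem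
    obtain ⟨s, rfl⟩ := Ideal.mem_span_singleton'.mp hj
    refine ⟨_, ⟨weightedHomogeneousComponent w (n - d) s,
      weightedHomogeneousComponent_mem w s (n - d), rfl⟩, ?_⟩
    have h := weightedHomogeneousComponent_eq_self hp
    rw [map_add, mul_comm s, component_mul_of_le hb hdn] at h
    change Ideal.Quotient.mk I b * Ideal.Quotient.mk I _ = Ideal.Quotient.mk I (i + s * b)
    rw [mul_comm s b, ← h, map_add, map_mul,
      Ideal.Quotient.eq_zero_iff_mem.mpr (hI.component_mem hi n), zero_add]
  · rintro ⟨_, ⟨p, hp, rfl⟩, rfl⟩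
    refine ⟨⟨_, b * p, ?_, rfl⟩, ?_, ?_⟩
    · have := hb.mul hp
      rwa [Nat.add_sub_cancel' hdn] at this
    · exact Ideal.Quotient.eq_zero_iff_mem.mpr
        (Ideal.mem_sup_right (Ideal.mem_span_singleton'.mpr ⟨p, mul_comm _ _⟩))
    · exact map_mul (Ideal.Quotient.mk I) b p

theorem finrank_ker_pieceMap_eq {I : Ideal (MvPolynomial σ K)} (hI : IsHomog w I)
    {b : MvPolynomial σ K} {d n : ℕ} (hb : b.IsWeightedHomogeneous w d) (hdn : d ≤ n) :
    Module.finrank K (LinearMap.ker (pieceMap w (le_sup_left : I ≤ I ⊔ Ideal.span {b}) n)) =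
      Module.finrank K ((gradedPiece w I (n - d)).map
        (LinearMap.mulLeft K (Ideal.Quotient.mk I b))) := by
  rw [← map_subtype_ker_pieceMap hI hb hdn]
  exact (Submodule.equivMapOfInjective _ (Submodule.injective_subtype _) _).finrank_eq

theorem hilbertFun_le [Finite σ] (hw : ∀ i, 0 < w i) {I : Ideal (MvPolynomial σ K)}
    (hI : IsHomog w I) {b : MvPolynomial σ K} {d n : ℕ} (hb : b.IsWeightedHomogeneous w d)
    (hdn : d ≤ n) :
    hilbertFun w I n ≤ hilbertFun w (I ⊔ Ideal.span {b}) n + hilbertFun w I (n - d) := by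
  have := finite_gradedPiece hw I (n - d)
  rw [← finrank_ker_add hw (le_sup_left : I ≤ I ⊔ Ideal.span {b}) n,
    finrank_ker_pieceMap_eq hI hb hdn]
  exact Nat.add_le_add_left (Submodule.finrank_map_le _ _) _

theorem RegularMod.hilbertFun_eq [Finite σ] (hw : ∀ i, 0 < w i) {I : Ideal (MvPolynomial σ K)}
    (hI : IsHomog w I) {b : MvPolynomial σ K} {d n : ℕ} (hb : b.IsWeightedHomogeneous w d)
    (hreg : RegularMod I b) (hdn : d ≤ n) :
    hilbertFun w I n = hilbertFun w (I ⊔ Ideal.span {b}) n + hilbertFun w I (n - d) := by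
  rw [← finrank_ker_add hw (le_sup_left : I ≤ I ⊔ Ideal.span {b}) n,
    finrank_ker_pieceMap_eq hI hb hdn]
  congr 1
  refine ((Submodule.equivMapOfInjective _ ?_ _).finrank_eq).symm
  rw [← LinearMap.ker_eq_bot, LinearMap.ker_eq_bot']
  intro q hq
  obtain ⟨p, rfl⟩ := Ideal.Quotient.mk_surjective q
  refine Ideal.Quotient.eq_zero_iff_mem.mpr (hreg _ ?_)
  rw [← Ideal.Quotient.eq_zero_iff_mem, map_mul]
  exact hq

theorem hilbertFun_eq_of_lt [Finite σ] (hw : ∀ i, 0 < w i) {I : Ideal (MvPolynomial σ K)}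
    (hI : IsHomog w I) {b : MvPolynomial σ K} {d n : ℕ} (hb : b.IsWeightedHomogeneous w d)
    (hdn : n < d) :
    hilbertFun w I n = hilbertFun w (I ⊔ Ideal.span {b}) n := by
  rw [← finrank_ker_add hw (le_sup_left : I ≤ I ⊔ Ideal.span {b}) n]
  suffices h : LinearMap.ker (pieceMap w (le_sup_left : I ≤ I ⊔ Ideal.span {b}) n) = ⊥ by
    rw [h, finrank_bot, add_zero]
  rw [LinearMap.ker_eq_bot']
  rintro ⟨_, p, hp, rfl⟩ hq
  have hmem : p ∈ I ⊔ Ideal.span {b} := Ideal.Quotient.eq_zero_iff_mem.mp hq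
  obtain ⟨i, hi, j, hj, rfl⟩ := Submodule.mem_sup.mp hmem
  obtain ⟨s, rfl⟩ := Ideal.mem_span_singleton'.mp hj
  have h := weightedHomogeneousComponent_eq_self hp
  rw [map_add, mul_comm s, component_mul_of_lt hb hdn, add_zero] at h
  refine Subtype.ext (Ideal.Quotient.eq_zero_iff_mem.mpr ?_)
  rw [mul_comm s b, ← h]
  exact hI.component_mem hi n

/-- The Hilbert series of the quotient by `I`. -/
noncomputable def hilbertSeries (w : σ → ℕ) (I : Ideal (MvPolynomial σ K)) : PowerSeries ℤ :=
  PowerSeries.mk fun n ↦ (hilbertFun w I n : ℤ)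

theorem RegularMod.hilbertSeries_eq [Finite σ] (hw : ∀ i, 0 < w i) {I : Ideal (MvPolynomial σ K)}
    (hI : IsHomog w I) {b : MvPolynomial σ K} {d : ℕ} (hb : b.IsWeightedHomogeneous w d)
    (hreg : RegularMod I b) :
    hilbertSeries w (I ⊔ Ideal.span {b}) = (1 - PowerSeries.X ^ d) * hilbertSeries w I := by
  ext n
  rw [sub_mul, one_mul, map_sub, PowerSeries.coeff_X_pow_mul']
  simp only [hilbertSeries, PowerSeries.coeff_mk]
  split_ifs with h
  · rw [hreg.hilbertFun_eq hw hI hb h]; push_cast; ring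
  · rw [← hilbertFun_eq_of_lt hw hI hb (not_le.mp h), sub_zero]

theorem RegularSeqMod.hilbertSeries_eq [Finite σ] (hw : ∀ i, 0 < w i) {ι : Type*}
    {f : ι → MvPolynomial σ K} {e : ι → ℕ} (hf : ∀ i, (f i).IsWeightedHomogeneous w (e i))
    (l : List ι) {I : Ideal (MvPolynomial σ K)} (hI : IsHomog w I)
    (h : RegularSeqMod I (l.map f)) :
    hilbertSeries w (I ⊔ Ideal.ofList (l.map f)) =
      (l.map fun i ↦ (1 - PowerSeries.X ^ e i : PowerSeries ℤ)).prod * hilbertSeries w I := by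
  induction l generalizing I with
  | nil => simp
  | cons i l ih =>
    obtain ⟨h1, h2⟩ := h
    rw [List.map_cons, Ideal.ofList_cons, ← sup_assoc, ih (hI.sup_span (hf i)) h2,
      h1.hilbertSeries_eq hw hI (hf i), List.map_cons, List.prod_cons]
    ring

theorem exists_forall_mem_of_varsNilpotent [Fintype σ] (w : σ → ℕ)
    {I : Ideal (MvPolynomial σ K)} (hI : VarsNilpotent I) :
    ∃ L, ∀ n, L ≤ n → ∀ p : MvPolynomial σ K, p.IsWeightedHomogeneous w n → p ∈ I := by
  choose k hk using hI
  refine ⟨∑ i, k i * w i + 1, fun n hn p hp ↦ ?_⟩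
  rw [p.as_sum]
  refine sum_mem fun m hm ↦ ?_
  have hwm := hp (mem_support_iff.mp hm)
  obtain ⟨i, hi⟩ : ∃ i, k i ≤ m i := by
    by_contra! h
    have : Finsupp.weight w m ≤ ∑ i, k i * w i := by
      rw [Finsupp.weight_apply, Finsupp.sum_fintype _ _ (by simp)]
      exact Finset.sum_le_sum fun i _ ↦ Nat.mul_le_mul_right _ (h i).le
    omega
  refine I.mem_of_dvd ?_ (hk i)
  rw [X_pow_eq_monomial, monomial_dvd_monomial]
  simp [hi]

theorem gradedPiece_eq_bot {I : Ideal (MvPolynomial σ K)} {n : ℕ}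
    (h : ∀ p : MvPolynomial σ K, p.IsWeightedHomogeneous w n → p ∈ I) : gradedPiece w I n = ⊥ := by
  rw [eq_bot_iff]
  rintro _ ⟨p, hp, rfl⟩
  exact Ideal.Quotient.eq_zero_iff_mem.mpr (h p hp)

theorem exists_hilbertFun_mul_le [Fintype σ] (hw : ∀ i, 0 < w i) {I : Ideal (MvPolynomial σ K)}
    (hI : IsHomog w I) {x : MvPolynomial σ K} {d : ℕ} (hd : 0 < d)
    (hx : x.IsWeightedHomogeneous w d) (h : VarsNilpotent (I ⊔ Ideal.span {x})) :
    ∃ D, hilbertFun w I (D * d) ≤ D := by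
  obtain ⟨L, hL⟩ := exists_forall_mem_of_varsNilpotent w h
  have hle : ∀ k, hilbertFun w I ((L + k) * d) ≤ hilbertFun w I (L * d) := by
    intro k
    induction k with
    | zero => simp
    | succ k ih =>
      have h1 : d ≤ (L + (k + 1)) * d := by nlinarith
      have h2 := hilbertFun_le hw hI hx h1
      have h3 : hilbertFun w (I ⊔ Ideal.span {x}) ((L + (k + 1)) * d) = 0 := by
        rw [hilbertFun, gradedPiece_eq_bot (hL _ (by nlinarith)), finrank_bot]
      have h4 : (L + (k + 1)) * d - d = (L + k) * d := by
        rw [← add_assoc, add_one_mul, Nat.add_sub_cancel]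
      rw [h3, zero_add, h4] at h2
      exact h2.trans ih
  exact ⟨L + hilbertFun w I (L * d), (hle _).trans (Nat.le_add_left _ _)⟩


theorem exists_polynomial_varsNilpotent [Fintype σ] (hw : ∀ i, 0 < w i)
    {I : Ideal (MvPolynomial σ K)} (hI : IsHomog w I) {x y : MvPolynomial σ K} {d : ℕ}
    (hd : 0 < d) (hx : x.IsWeightedHomogeneous w d) (hy : y.IsWeightedHomogeneous w d)
    (h : VarsNilpotent (I ⊔ Ideal.span {x})) :
    ∃ p : Polynomial K, p ≠ 0 ∧ ∀ c, p.eval c ≠ 0 →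
      VarsNilpotent (I ⊔ Ideal.span {y - C c * x}) := by
  obtain ⟨D, hD⟩ := exists_hilbertFun_mul_le hw hI hd hx h
  have hdeg (i : Fin (D + 1)) : (y ^ (i : ℕ) * x ^ (D - i)).IsWeightedHomogeneous w (D * d) := by
    have := (hy.pow i).mul (hx.pow (D - i))
    rwa [← add_smul, Nat.add_sub_cancel' (Nat.lt_succ_iff.mp i.2), smul_eq_mul] at this
  let v : Fin (D + 1) → gradedPiece w I (D * d) := fun i ↦
    ⟨Ideal.Quotient.mkₐ K I (y ^ (i : ℕ) * x ^ (D - i)), _, hdeg i, rfl⟩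
  have hv : ¬ LinearIndependent K v := fun hli ↦ by
    have := finite_gradedPiece hw I (D * d)
    have := hli.fintype_card_le_finrank
    rw [Fintype.card_fin] at this
    exact absurd (this.trans hD) (by omega)
  obtain ⟨a, ha, j, hj⟩ := Fintype.not_linearIndependent_iff.mp hv
  have hmem : ∑ i : Fin (D + 1), C (a i) * (y ^ (i : ℕ) * x ^ (D - i)) ∈ I := by
    rw [← Ideal.Quotient.eq_zero_iff_mem]
    have := congrArg Subtype.val ha
    simp only [v, Submodule.coe_sum, Submodule.coe_smul, ← map_smul, ← map_sum,
      MvPolynomial.smul_eq_C_mul] at this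
    exact this
  refine ⟨∑ i : Fin (D + 1), Polynomial.C (a i) * Polynomial.X ^ (i : ℕ),
    fun h0 ↦ hj ?_, fun c hc ↦ ?_⟩
  · have := congrArg (Polynomial.coeff · (j : ℕ)) h0
    simpa [Polynomial.finsetSum_coeff, Polynomial.coeff_C_mul, Polynomial.coeff_X_pow,
      Fin.val_inj] using this
  · refine h.of_mem_radical le_sup_left ⟨D, ?_⟩
    set J := I ⊔ Ideal.span {y - C c * x}
    have hyx : Ideal.Quotient.mk J y = Ideal.Quotient.mk J (C c * x) :=
      Ideal.Quotient.eq.mpr (Ideal.mem_sup_right (Ideal.mem_span_singleton_self _))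
    have hmem' := Ideal.Quotient.eq_zero_iff_mem.mpr ((le_sup_left : I ≤ J) hmem)
    have hev : Ideal.Quotient.mk J (C
        ((∑ i : Fin (D + 1), Polynomial.C (a i) * Polynomial.X ^ (i : ℕ)).eval c) * x ^ D) = 0 := by
      rw [← hmem', Polynomial.eval_finsetSum, map_sum, Finset.sum_mul, map_sum, map_sum]
      refine Finset.sum_congr rfl fun i _ ↦ ?_
      have hi : (i : ℕ) + (D - i) = D := Nat.add_sub_cancel' (Nat.lt_succ_iff.mp i.2)
      rw [map_mul, map_mul (Ideal.Quotient.mk J), map_mul (Ideal.Quotient.mk J),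
        map_pow (Ideal.Quotient.mk J) y, hyx, ← map_pow, ← map_mul, ← map_mul, ← map_mul]
      congr 1
      have hxD : x ^ D = x ^ (i : ℕ) * x ^ (D - i) := by rw [← pow_add, hi]
      rw [hxD]
      simp
      ring
    rw [Ideal.Quotient.eq_zero_iff_mem] at hev
    have := J.mul_mem_left (C
      ((∑ i : Fin (D + 1), Polynomial.C (a i) * Polynomial.X ^ (i : ℕ)).eval c)⁻¹) hev
    rwa [← mul_assoc, ← map_mul, inv_mul_cancel₀ hc, map_one, one_mul] at this

theorem VarsNilpotent.span_pow {I : Ideal (MvPolynomial σ K)} {x : MvPolynomial σ K}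
    (h : VarsNilpotent (I ⊔ Ideal.span {x})) (n : ℕ) :
    VarsNilpotent (I ⊔ Ideal.span {x ^ n}) :=
  h.of_mem_radical le_sup_left ⟨n, Ideal.mem_sup_right (Ideal.mem_span_singleton_self _)⟩

theorem exists_common_parameter [Infinite K] [Fintype σ] (hw : ∀ i, 0 < w i)
    {I J : Ideal (MvPolynomial σ K)} (hI : IsHomog w I) (hJ : IsHomog w J)
    {x y : MvPolynomial σ K} {d e : ℕ} (hd : 0 < d) (he : 0 < e)
    (hx : x.IsWeightedHomogeneous w d) (hy : y.IsWeightedHomogeneous w e)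
    (hIx : VarsNilpotent (I ⊔ Ideal.span {x})) (hJy : VarsNilpotent (J ⊔ Ideal.span {y})) :
    ∃ z n, 0 < n ∧ IsWeightedHomogeneous w z n ∧
      VarsNilpotent (I ⊔ Ideal.span {z}) ∧ VarsNilpotent (J ⊔ Ideal.span {z}) := by
  have hx' := hx.pow e
  have hy' := hy.pow d
  rw [smul_eq_mul] at hx' hy'
  rw [mul_comm] at hy'
  have hde := Nat.mul_pos he hd
  obtain ⟨p, hp0, hp⟩ := exists_polynomial_varsNilpotent hw hI hde hx' hy' (hIx.span_pow e)
  obtain ⟨q, hq0, hq⟩ := exists_polynomial_varsNilpotent hw hJ hde hy' hx' (hJy.span_pow d)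
  classical
  obtain ⟨c, hc⟩ := Infinite.exists_notMem_finset
    (insert 0 (p.roots.toFinset ∪ q.roots.toFinset.image (·⁻¹)))
  simp only [Finset.mem_insert, Finset.mem_union, Finset.mem_image, Multiset.mem_toFinset,
    not_or, not_exists, not_and] at hc
  obtain ⟨hc0, hcp, hcq⟩ := hc
  refine ⟨y ^ d - C c * x ^ e, e * d, hde, hy'.sub (hx'.C_mul c), hp c fun h ↦ ?_, ?_⟩
  · exact hcp ((Polynomial.mem_roots hp0).mpr h)
  · have := hq c⁻¹ fun h ↦ hcq c⁻¹ ((Polynomial.mem_roots hq0).mpr h) (inv_inv c)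
    refine this.of_mem_radical le_sup_left (Ideal.le_radical (Ideal.mem_sup_right ?_))
    refine Ideal.mem_span_singleton'.mpr ⟨-C c⁻¹, ?_⟩
    have hcc : (C c⁻¹ * C c : MvPolynomial σ K) = 1 := by
      rw [← map_mul, inv_mul_cancel₀ hc0, map_one]
    linear_combination x ^ e * hcc

theorem isHomog_sup_ofList {I : Ideal (MvPolynomial σ K)} (hI : IsHomog w I)
    {l : List (MvPolynomial σ K)} (hl : AllHomog w l) : IsHomog w (I ⊔ Ideal.ofList l) :=
  Ideal.IsHomogeneous.sup hI (Ideal.homogeneous_span _ _ fun a ha ↦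
    let ⟨d, _, h⟩ := hl a ha; ⟨d, h⟩)

/-- If some homogeneous system of parameters modulo `I` is a regular sequence, then every
homogeneous system of parameters of the same length is. -/
theorem RegularSeqMod.of_varsNilpotent [Infinite K] [Fintype σ] (hw : ∀ i, 0 < w i)
    {l l' : List (MvPolynomial σ K)} (hlen : l.length = l'.length) (hl : AllHomog w l)
    (hl' : AllHomog w l') {I : Ideal (MvPolynomial σ K)} (hI : IsHomog w I)
    (hreg : RegularSeqMod I l) (h : VarsNilpotent (I ⊔ Ideal.ofList l))
    (h' : VarsNilpotent (I ⊔ Ideal.ofList l')) : RegularSeqMod I l' := by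
  induction l generalizing l' I with
  | nil => rw [List.eq_nil_of_length_eq_zero hlen.symm]; trivial
  | cons a l ih =>
    obtain _ | ⟨b, l'⟩ := l'
    · simp at hlen
    obtain ⟨d, hd, ha⟩ := hl a (by simp)
    obtain ⟨e, he, hb⟩ := hl' b (by simp)
    have hl : AllHomog w l := fun c hc ↦ hl c (by simp [hc])
    have hl' : AllHomog w l' := fun c hc ↦ hl' c (by simp [hc])
    rw [Ideal.ofList_cons, sup_comm (Ideal.span _), ← sup_assoc] at h h'
    obtain ⟨z, n, hn, hz, hIz, hIz'⟩ := exists_common_parameter hw (isHomog_sup_ofList hI hl)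
      (isHomog_sup_ofList hI hl') hd he ha hb h h'
    obtain ⟨hl_reg, ha_reg⟩ := (regularSeqMod_cons_iff hl hI hd ha).mp hreg
    have hzl : RegularSeqMod I (z :: l) := (regularSeqMod_cons_iff hl hI hn hz).mpr
      ⟨hl_reg, ha_reg.of_pow_mem (hIz.mem_radical hd ha)⟩
    have hzl' : RegularSeqMod I (z :: l') := by
      refine ⟨hzl.1, ih (by simpa using hlen) hl hl' (hI.sup_span hz) hzl.2 ?_ ?_⟩
      · rwa [sup_right_comm]
      · rwa [sup_right_comm]
    obtain ⟨hl'_reg, hz_reg⟩ := (regularSeqMod_cons_iff hl' hI hn hz).mp hzl'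
    exact (regularSeqMod_cons_iff hl' hI he hb).mpr
      ⟨hl'_reg, hz_reg.of_pow_mem (h'.mem_radical hn hz)⟩

theorem regularSeqMod_span_X (l : List σ) (hl : l.Nodup) (s : Set σ) (hs : ∀ i ∈ l, i ∉ s) :
    RegularSeqMod (Ideal.span (X '' s : Set (MvPolynomial σ K))) (l.map X) := by
  induction l generalizing s with
  | nil => trivial
  | cons i l ih =>
    rw [List.nodup_cons] at hl
    refine ⟨fun r hr ↦ ?_, ?_⟩
    · rw [mem_ideal_span_X_image] at hr ⊢
      intro m hm
      obtain ⟨j, hj, hmj⟩ := hr (m + Finsupp.single i 1) (by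
        rw [mem_support_iff] at hm ⊢
        rwa [mul_comm, coeff_mul_X])
      have hij : i ≠ j := fun h ↦ hs i (by simp) (h ▸ hj)
      exact ⟨j, hj, by simpa [Finsupp.single_apply, hij] using hmj⟩
    · rw [sup_comm, ← Ideal.span_union, Set.singleton_union, ← Set.image_insert_eq]
      refine ih hl.2 _ fun j hj ↦ ?_
      rw [Set.mem_insert_iff, not_or]
      exact ⟨fun h ↦ hl.1 (h ▸ hj), hs j (by simp [hj])⟩

/-- Polynomials all of whose terms have weight less than `n`. -/
noncomputable def degreeLT (K : Type*) [Field K] (w : σ → ℕ) (n : ℕ) :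
    Submodule K (MvPolynomial σ K) :=
  ⨅ k ≥ n, LinearMap.ker (weightedHomogeneousComponent w k)

theorem mem_degreeLT {n : ℕ} {p : MvPolynomial σ K} :
    p ∈ degreeLT K w n ↔ ∀ k ≥ n, weightedHomogeneousComponent w k p = 0 := by
  simp [degreeLT]

theorem degreeLT_zero : degreeLT K w 0 = ⊥ := by
  refine (Submodule.eq_bot_iff _).mpr fun p hp ↦ ?_
  rw [← sum_weightedHomogeneousComponent w p]
  exact finsum_eq_zero_of_forall_eq_zero fun n ↦ mem_degreeLT.mp hp n n.zero_le

theorem degreeLT_succ (n : ℕ) :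
    degreeLT K w (n + 1) = degreeLT K w n ⊔ weightedHomogeneousSubmodule K w n := by
  apply le_antisymm
  · intro p hp
    rw [← sub_add_cancel p (weightedHomogeneousComponent w n p)]
    refine Submodule.add_mem_sup (mem_degreeLT.mpr fun k hk ↦ ?_)
      (weightedHomogeneousComponent_mem w p n)
    rw [map_sub, weightedHomogeneousComponent_of_mem (weightedHomogeneousComponent_mem w p n)]
    split_ifs with h
    · rw [h, sub_self]
    · rw [mem_degreeLT.mp hp k (by omega), sub_zero]
  · refine sup_le (fun p hp ↦ mem_degreeLT.mpr fun k hk ↦ mem_degreeLT.mp hp k (by omega)) ?_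
    intro p hp
    refine mem_degreeLT.mpr fun k hk ↦ ?_
    rw [weightedHomogeneousComponent_of_mem hp, if_neg (by omega)]

theorem exists_mem_degreeLT (p : MvPolynomial σ K) : ∃ n, p ∈ degreeLT K w n :=
  ⟨weightedTotalDegree w p + 1, mem_degreeLT.mpr fun _ hk ↦
    weightedHomogeneousComponent_eq_zero _ _ hk⟩

theorem finrank_map_degreeLT [Finite σ] (hw : ∀ i, 0 < w i) {I : Ideal (MvPolynomial σ K)}
    (hI : IsHomog w I) (n : ℕ) :
    Module.Finite K ((degreeLT K w n).map (Ideal.Quotient.mkₐ K I).toLinearMap) ∧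
    Module.finrank K ((degreeLT K w n).map (Ideal.Quotient.mkₐ K I).toLinearMap) =
      ∑ k ∈ Finset.range n, hilbertFun w I k := by
  induction n with
  | zero =>
    rw [degreeLT_zero, Submodule.map_bot]
    exact ⟨inferInstance, by simp⟩
  | succ n ih =>
    obtain ⟨hfin, hrank⟩ := ih
    have hfin' := finite_gradedPiece hw I n
    have hinf : (degreeLT K w n).map (Ideal.Quotient.mkₐ K I).toLinearMap ⊓ gradedPiece w I n =
        ⊥ := by
      refine (Submodule.eq_bot_iff _).mpr ?_
      rintro _ ⟨⟨p, hp, rfl⟩, q, hq, hpq⟩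
      rw [← hpq]
      refine Ideal.Quotient.eq_zero_iff_mem.mpr ?_
      have := hI.component_mem (Ideal.Quotient.eq.mp hpq) n
      rwa [map_sub, weightedHomogeneousComponent_eq_self hq, mem_degreeLT.mp hp n le_rfl,
        sub_zero] at this
    rw [degreeLT_succ, Submodule.map_sup, Finset.sum_range_succ, ← hrank, hilbertFun]
    refine ⟨Submodule.finite_sup _ (gradedPiece w I n), ?_⟩
    have := Submodule.finrank_sup_add_finrank_inf_eq
      ((degreeLT K w n).map (Ideal.Quotient.mkₐ K I).toLinearMap) (gradedPiece w I n)
    rwa [hinf, finrank_bot, add_zero] at this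

theorem finrank_quotient_eq_sum [Finite σ] (hw : ∀ i, 0 < w i) {I : Ideal (MvPolynomial σ K)}
    (hI : IsHomog w I) {L : ℕ} (hL : ∀ n, L ≤ n → gradedPiece w I n = ⊥) :
    Module.finrank K (MvPolynomial σ K ⧸ I) = ∑ k ∈ Finset.range L, hilbertFun w I k := by
  rw [← (finrank_map_degreeLT hw hI L).2]
  have hle : ∀ k, (degreeLT K w (L + k)).map (Ideal.Quotient.mkₐ K I).toLinearMap ≤
      (degreeLT K w L).map (Ideal.Quotient.mkₐ K I).toLinearMap := by
    intro k
    induction k with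
    | zero => exact le_rfl
    | succ k ih =>
      rw [← add_assoc, degreeLT_succ, Submodule.map_sup]
      exact sup_le ih ((hL (L + k) (by omega)).trans_le bot_le)
  suffices h : (degreeLT K w L).map (Ideal.Quotient.mkₐ K I).toLinearMap = ⊤ by
    rw [h, finrank_top]
  refine eq_top_iff.mpr fun q _ ↦ ?_
  obtain ⟨p, rfl⟩ := Ideal.Quotient.mk_surjective q
  obtain ⟨n, hn⟩ := exists_mem_degreeLT (w := w) p
  exact hle n ⟨p, mem_degreeLT.mpr fun k hk ↦ mem_degreeLT.mp hn k (by omega), rfl⟩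

theorem exists_polynomial_hilbertSeries [Fintype σ] (hw : ∀ i, 0 < w i)
    {I : Ideal (MvPolynomial σ K)} (hI : IsHomog w I) (h : VarsNilpotent I) :
    ∃ p : Polynomial ℤ, (p : PowerSeries ℤ) = hilbertSeries w I ∧
      p.eval 1 = Module.finrank K (MvPolynomial σ K ⧸ I) := by
  obtain ⟨L, hL⟩ := exists_forall_mem_of_varsNilpotent w h
  have hbot : ∀ n, L ≤ n → gradedPiece w I n = ⊥ := fun n hn ↦ gradedPiece_eq_bot (hL n hn)
  refine ⟨∑ k ∈ Finset.range L, Polynomial.C (hilbertFun w I k : ℤ) * Polynomial.X ^ k, ?_, ?_⟩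
  · ext n
    rw [Polynomial.coeff_coe, hilbertSeries, PowerSeries.coeff_mk]
    simp only [Polynomial.finsetSum_coeff, Polynomial.coeff_C_mul, Polynomial.coeff_X_pow,
      mul_ite, mul_one, mul_zero,
      Finset.sum_ite_eq, Finset.mem_range]
    split_ifs with hn
    · rfl
    · rw [hilbertFun, hbot n (not_lt.mp hn), finrank_bot, Nat.cast_zero]
  · rw [finrank_quotient_eq_sum hw hI hbot]
    simp [Polynomial.eval_finsetSum]

theorem finrank_quotient_span_range_X :
    Module.finrank K (MvPolynomial σ K ⧸ Ideal.span (Set.range (X : σ → MvPolynomial σ K))) =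
      1 := by
  rw [← Set.image_univ]
  refine finrank_eq_one 1 (fun h ↦ ?_) fun q ↦ ?_
  · have h1 := Ideal.Quotient.eq_zero_iff_mem.mp h
    rw [mem_ideal_span_X_image] at h1
    obtain ⟨i, -, hi⟩ := h1 0 (by simp)
    exact hi rfl
  · obtain ⟨p, rfl⟩ := Ideal.Quotient.mk_surjective q
    refine ⟨constantCoeff p, ?_⟩
    rw [← map_one (Ideal.Quotient.mkₐ K _), ← map_smul]
    refine Ideal.Quotient.eq.mpr (mem_ideal_span_X_image.mpr fun m hm ↦ ?_)
    by_contra! h0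
    obtain rfl : m = 0 := Finsupp.ext fun i ↦ h0 i trivial
    simp [mem_support_iff, constantCoeff_eq] at hm

theorem varsNilpotent_of_finite {I : Ideal (MvPolynomial σ K)} (hI : IsHomog w I)
    (hw : ∀ i, 0 < w i) [Module.Finite K (MvPolynomial σ K ⧸ I)] : VarsNilpotent I := by
  intro i
  obtain ⟨p, hp, hroot⟩ := Algebra.IsIntegral.isIntegral (R := K) (Ideal.Quotient.mkₐ K I (X i))
  rw [← Polynomial.aeval_def, Polynomial.aeval_algHom_apply] at hroot
  have hmem := hI.component_mem (Ideal.Quotient.eq_zero_iff_mem.mp hroot) (p.natDegree * w i)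
  refine ⟨p.natDegree, ?_⟩
  convert hmem using 1
  have hX (k : ℕ) : X i ^ k ∈ weightedHomogeneousSubmodule K w (k * w i) :=
    (isWeightedHomogeneous_X K w i).pow k
  rw [Polynomial.aeval_eq_sum_range, map_sum, Finset.sum_range_succ, map_smul,
    weightedHomogeneousComponent_of_mem (hX _), if_pos rfl, hp.coeff_natDegree, one_smul,
    Finset.sum_eq_zero, zero_add]
  intro k hk
  rw [map_smul, weightedHomogeneousComponent_of_mem (hX _), if_neg, smul_zero]
  exact fun h ↦ (Finset.mem_range.mp hk).ne' (Nat.eq_of_mul_eq_mul_right (hw i) h)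

theorem mul_prod_eq_of_mul_prod_one_sub_X_pow_eq {ι : Type*} [Fintype ι] {p q : Polynomial ℤ}
    {d e : ι → ℕ}
    (h : p * ∏ i, (1 - Polynomial.X ^ d i) = q * ∏ i, (1 - Polynomial.X ^ e i)) :
    p.eval 1 * ∏ i, (d i : ℤ) = q.eval 1 * ∏ i, (e i : ℤ) := by
  have hgeom (n : ℕ) : (1 - Polynomial.X ^ n : Polynomial ℤ) =
      (∑ k ∈ Finset.range n, Polynomial.X ^ k) * (1 - Polynomial.X) :=
    (geom_sum_mul_neg Polynomial.X n).symm
  simp_rw [hgeom, Finset.prod_mul_distrib, ← mul_assoc] at h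
  have hne : (1 - Polynomial.X : Polynomial ℤ) ≠ 0 := fun h0 ↦ by
    simpa using congrArg (Polynomial.eval 0) h0
  have := congrArg (Polynomial.eval 1)
    (mul_right_cancel₀ (Finset.prod_ne_zero_iff.mpr fun _ _ ↦ hne) h)
  simpa [Polynomial.eval_mul, Polynomial.eval_prod, Polynomial.eval_finsetSum] using this

theorem span_eq_top_of_isWeightedHomogeneous_zero (hw : ∀ i, 0 < w i) {f : MvPolynomial σ K}
    (hf : f ≠ 0) (h : f.IsWeightedHomogeneous w 0) : Ideal.span {f} = ⊤ := by
  classical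
  have hfC : f = C (coeff 0 f) := by
    ext m
    rw [coeff_C]
    split_ifs with hm
    · rw [hm]
    · refine h.coeff_eq_zero m fun h0 ↦ hm ?_
      exact (Finsupp.ext ((weightedDegree_eq_zero_iff
        (nonTorsionWeight_of fun i ↦ (hw i).ne')).mp h0)).symm
  rw [Ideal.span_singleton_eq_top, hfC]
  refine (IsUnit.mk0 _ fun h0 ↦ hf ?_).map C
  rw [hfC, h0, map_zero]

theorem ofList_map_toList_univ [Fintype σ] {R : Type*} [CommRing R] (f : σ → R) :
    Ideal.ofList (Finset.univ.toList.map f) = Ideal.span (Set.range f) := by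
  simp [Ideal.ofList, Set.range]

/-- **Weighted Bézout theorem** for a finite-dimensional weighted complete intersection. -/
theorem finrank_mul_prod_weights [Infinite K] [Fintype σ] (hw : ∀ i, 0 < w i) {e : σ → ℕ}
    {f : σ → MvPolynomial σ K} (hf : ∀ i, f i ≠ 0)
    (hhom : ∀ i, (f i).IsWeightedHomogeneous w (e i))
    [Module.Finite K (MvPolynomial σ K ⧸ Ideal.span (Set.range f))] :
    Module.finrank K (MvPolynomial σ K ⧸ Ideal.span (Set.range f)) * ∏ i, w i = ∏ i, e i := by
  by_cases he : ∃ i, e i = 0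
  · obtain ⟨i, hi⟩ := he
    have htop : Ideal.span (Set.range f) = ⊤ := by
      rw [eq_top_iff, ← span_eq_top_of_isWeightedHomogeneous_zero hw (hf i) (hi ▸ hhom i)]
      exact Ideal.span_mono (by rintro _ rfl; exact ⟨i, rfl⟩)
    have := Ideal.Quotient.subsingleton_iff.mpr htop
    rw [Module.finrank_zero_of_subsingleton, zero_mul,
      Finset.prod_eq_zero (Finset.mem_univ i) hi]
  push Not at he
  have hX (i : σ) := isWeightedHomogeneous_X K w i
  have hhomog {g : σ → MvPolynomial σ K} {d : σ → ℕ}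
      (hg : ∀ i, (g i).IsWeightedHomogeneous w (d i)) : IsHomog w (Ideal.span (Set.range g)) :=
    Ideal.homogeneous_span _ _ (by rintro _ ⟨i, rfl⟩; exact ⟨d i, hg i⟩)
  have hlX : AllHomog w (Finset.univ.toList.map (X : σ → MvPolynomial σ K)) := by
    intro a ha
    obtain ⟨i, -, rfl⟩ := List.mem_map.mp ha
    exact ⟨_, hw i, hX i⟩
  have hlf : AllHomog w (Finset.univ.toList.map f) := by
    intro a ha
    obtain ⟨i, -, rfl⟩ := List.mem_map.mp ha
    exact ⟨_, Nat.pos_of_ne_zero (he i), hhom i⟩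
  have hbot : IsHomog w (⊥ : Ideal (MvPolynomial σ K)) := Ideal.IsHomogeneous.bot _
  have hnX : VarsNilpotent (Ideal.span (Set.range (X : σ → MvPolynomial σ K))) := fun i ↦
    Ideal.le_radical (Ideal.subset_span ⟨i, rfl⟩)
  have hnf := varsNilpotent_of_finite (hhomog hhom) hw
  have hregX : RegularSeqMod ⊥ (Finset.univ.toList.map (X : σ → MvPolynomial σ K)) := by
    simpa using regularSeqMod_span_X (K := K) _ (Finset.nodup_toList Finset.univ) ∅ (by simp)
  have hregf : RegularSeqMod ⊥ (Finset.univ.toList.map f) := by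
    refine hregX.of_varsNilpotent hw (by simp) hlX hlf hbot ?_ ?_
    · rwa [bot_sup_eq, ofList_map_toList_univ]
    · rwa [bot_sup_eq, ofList_map_toList_univ]
  obtain ⟨p, hp, hp1⟩ := exists_polynomial_hilbertSeries hw (hhomog hhom) hnf
  obtain ⟨q, hq, hq1⟩ := exists_polynomial_hilbertSeries hw (hhomog hX) hnX
  have hHX := hregX.hilbertSeries_eq hw hX _ hbot
  have hHf := hregf.hilbertSeries_eq hw hhom _ hbot
  rw [bot_sup_eq, ofList_map_toList_univ, Finset.prod_map_toList] at hHX hHf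
  have hpq : p * ∏ i, (1 - Polynomial.X ^ w i) = q * ∏ i, (1 - Polynomial.X ^ e i) := by
    apply Polynomial.coe_injective
    have hcoe (d : σ → ℕ) : ((∏ i, (1 - Polynomial.X ^ d i) : Polynomial ℤ) : PowerSeries ℤ) =
        ∏ i, (1 - PowerSeries.X ^ d i) := by
      rw [← Polynomial.coeToPowerSeries.ringHom_apply, map_prod]
      simp
    rw [Polynomial.coe_mul, Polynomial.coe_mul, hcoe, hcoe, hp, hq, hHX, hHf]
    ring
  have := mul_prod_eq_of_mul_prod_one_sub_X_pow_eq hpq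
  rw [hp1, hq1, finrank_quotient_span_range_X, Nat.cast_one, one_mul] at this
  exact_mod_cast this

end WeightedCompleteIntersection

/-- for nonzero weighted homogeneous polynomials `f₁,…,f_N` of degrees
`e₁,…,e_N` in `N` variables of weights `w₁,…,w_N`, if `A = ℂ[x]/(f₁,…,f_N)` is
finite-dimensional then `dim_ℂ(A) · w₁⋯w_N = e₁⋯e_N`. -/
theorem stmt12 (N : ℕ) (hN : 1 ≤ N) (w : Fin N → ℕ) (hw : ∀ j, 0 < w j)
    (e : Fin N → ℕ) (f : Fin N → MvPolynomial (Fin N) ℂ)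
    (hf : ∀ i, f i ≠ 0)
    (hhom : ∀ i, (f i).IsWeightedHomogeneous w (e i))
    (hfin : FiniteDimensional ℂ (MvPolynomial (Fin N) ℂ ⧸ Ideal.span (Set.range f))) :
    Module.finrank ℂ (MvPolynomial (Fin N) ℂ ⧸ Ideal.span (Set.range f)) * ∏ j, w j
      = ∏ i, e i := by
  exact WeightedCompleteIntersection.finrank_mul_prod_weights hw hf hhom
end
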